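/- Consider the multiple isotonic regression model Y_i = f₀(X_i) + ξ_i, where f₀ and x₀ satisfy Assumption A1 with parameters s and α = (α_1,…,α_d), the design points follow the β-fixed lattice design, and the errors ξ_i are i.i.d. mean-zero random variables with variance σ² ∈ (0,∞). Let κ_* and n_* be as defined for the fixed lattice design. Then the max-min block estimator satisfies (n_*/σ²)^{1/(2 + Σ_{k=κ_*}^s α_k^{−1})} · (f̂_n(x₀) − f₀(x₀)) = O_P(1) as n → ∞ (with the convention that the sum Σ_{k=κ_*}^s α_k^{−1} is 0 when κ_* > s). -/

import Mathlib

open MeasureTheory Filter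

/-- Iterated partial derivative in the `k`-th coordinate (one step). -/
noncomputable def pderiv (d : ℕ) (k : Fin d) (f : (Fin d → ℝ) → ℝ) : (Fin d → ℝ) → ℝ :=
  fun x => fderiv ℝ f x (Pi.single k 1)

/-- `j`-fold iterated partial derivative in the `k`-th coordinate. -/
noncomputable def pderivIter (d : ℕ) (k : Fin d) (j : ℕ) (f : (Fin d → ℝ) → ℝ) :
    (Fin d → ℝ) → ℝ :=
  (pderiv d k)^[j] f

/-- Mixed partial derivative `∂^𝐣 = ∂_1^{j_1} ⋯ ∂_d^{j_d}`. -/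
noncomputable def mixedPDeriv (d : ℕ) (j : Fin d → ℕ) (f : (Fin d → ℝ) → ℝ) :
    (Fin d → ℝ) → ℝ :=
  (List.finRange d).foldr (fun k g => pderivIter d k (j k) g) f

/-- The anisotropic Taylor polynomial of `f` at `x₀` over the multi-index set
`J₀ = {𝐣 : j_k = 0 for k > s, Σ_{k≤s} j_k/α_k ≤ 1}`. -/
noncomputable def taylorJ0 (d s : ℕ) (α : Fin d → ℕ) (f : (Fin d → ℝ) → ℝ)
    (x₀ x : Fin d → ℝ) : ℝ :=
  ∑ j : (∀ k : Fin d, Fin (α k + 1)),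
    if (∀ k : Fin d, s ≤ (k : ℕ) → (j k : ℕ) = 0) ∧
        (∑ k : Fin d, if (k : ℕ) < s then ((j k : ℕ) : ℝ) / (α k : ℝ) else 0) ≤ 1 then
      (mixedPDeriv d (fun k => (j k : ℕ)) f x₀ /
          ∏ k : Fin d, (Nat.factorial (j k : ℕ) : ℝ)) *
        ∏ k : Fin d, (x k - x₀ k) ^ ((j k : ℕ))
    else 0

/-- Anisotropic localization rates: `(r_n)_k = ω^{1/α_k}` for `k ≤ s` and `1` otherwise. -/
noncomputable def rVec (d s : ℕ) (α : Fin d → ℕ) (ωn : ℝ) : Fin d → ℝ :=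
  fun k => if (k : ℕ) < s then ωn ^ ((α k : ℝ)⁻¹) else 1

/-- Assumption A1: local anisotropic smoothness of the isotonic function `f₀` at `x₀`
with intrinsic dimension `s` and smoothness indices `α`. -/
def AssumptionA1 (d s : ℕ) (α : Fin d → ℕ) (f₀ : (Fin d → ℝ) → ℝ)
    (x₀ : Fin d → ℝ) : Prop :=
  s ≤ d ∧
  (∀ k : Fin d, x₀ k ∈ Set.Ioo (0 : ℝ) 1) ∧
  MonotoneOn f₀ (Set.Icc (0 : Fin d → ℝ) 1) ∧
  (∀ k : Fin d, (k : ℕ) < s → 1 ≤ α k) ∧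
  (∃ U : Set (Fin d → ℝ), IsOpen U ∧ x₀ ∈ U ∧
    ContDiffOn ℝ (((Finset.univ.filter (fun k : Fin d => (k : ℕ) < s)).sup α : ℕ)) f₀ U) ∧
  (∀ k : Fin d, (k : ℕ) < s →
    (∀ j : ℕ, 1 ≤ j → j ≤ α k - 1 → pderivIter d k j f₀ x₀ = 0) ∧
      pderivIter d k (α k) f₀ x₀ ≠ 0) ∧
  (∀ L₀ : ℝ, 0 < L₀ → ∀ ω : ℕ → ℝ, (∀ n, 0 < ω n) → Antitone ω →
    Tendsto ω atTop (nhds 0) →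
    Tendsto (fun n =>
      (ω n)⁻¹ * sSup {y : ℝ | ∃ x : Fin d → ℝ, x ∈ Set.Icc (0 : Fin d → ℝ) 1 ∧
        (∀ k : Fin d, |x k - x₀ k| ≤ L₀ * rVec d s α (ω n) k) ∧
        y = |f₀ x - taylorJ0 d s α f₀ x₀ x|}) atTop (nhds 0))

/-- Number of lattice points along dimension `k` at stage `n`: `⌊n^{β_k}⌋`. -/
noncomputable def latticeDim (d : ℕ) (β : Fin d → ℝ) (n : ℕ) (k : Fin d) : ℕ :=
  Nat.floor ((n : ℝ) ^ (β k))

/-- The lattice design point indexed by `v`, with per-dimension starting points `a n`. -/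
noncomputable def latticePt (d : ℕ) (β : Fin d → ℝ) (a : ℕ → Fin d → ℝ) (n : ℕ)
    (v : ∀ k : Fin d, Fin (latticeDim d β n k)) : Fin d → ℝ :=
  fun k => a n k + (v k : ℝ) / (latticeDim d β n k : ℝ)

/-- Average of the observations `Y` over the design points lying in the block `[xu, xv]`
(zero if the block contains no design point). -/
noncomputable def blockAvg {d : ℕ} {ι : Type*} [Fintype ι] (X : ι → (Fin d → ℝ))
    (Y : ι → ℝ) (xu xv : Fin d → ℝ) : ℝ :=
  haveI := Classical.decPred fun i => X i ∈ Set.Icc xu xv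
  (∑ i ∈ Finset.univ.filter (fun i => X i ∈ Set.Icc xu xv), Y i) /
    ((Finset.univ.filter (fun i => X i ∈ Set.Icc xu xv)).card : ℝ)

/-- The max–min block estimator at `x₀`. -/
noncomputable def maxMinEst {d : ℕ} {ι : Type*} [Fintype ι] (X : ι → (Fin d → ℝ))
    (Y : ι → ℝ) (x₀ : Fin d → ℝ) : ℝ :=
  sSup {z : ℝ | ∃ xu : Fin d → ℝ, xu ≤ x₀ ∧
    z = sInf {w : ℝ | ∃ xv : Fin d → ℝ, x₀ ≤ xv ∧ (∃ i : ι, X i ∈ Set.Icc xu xv) ∧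
      w = blockAvg X Y xu xv}}


/-- running maximum -/
noncomputable def runMax (g : ℕ → ℝ) : ℕ → ℝ
  | 0 => g 0
  | n + 1 => max (runMax g n) (g (n + 1))

lemma runMax_congr {g h : ℕ → ℝ} : ∀ {n : ℕ}, (∀ j ≤ n, g j = h j) → runMax g n = runMax h n
  | 0, H => by simp [runMax, H 0 le_rfl]
  | n + 1, H => by
      simp only [runMax]
      rw [runMax_congr (n := n) (fun j hj => H j (by omega)), H (n + 1) le_rfl]

lemma le_runMax (g : ℕ → ℝ) : ∀ {n j : ℕ}, j ≤ n → g j ≤ runMax g n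
  | 0, j, h => by
      obtain rfl : j = 0 := by omega
      simp [runMax]
  | n + 1, j, h => by
      simp only [runMax]
      rcases Nat.lt_or_ge n j with h1 | h1
      · obtain rfl : j = n + 1 := by omega
        exact le_max_right _ _
      · exact (le_runMax g h1).trans (le_max_left _ _)

lemma runMax_le_sum (g : ℕ → ℝ) (hg : ∀ j, 0 ≤ g j) :
    ∀ n : ℕ, runMax g n ≤ ∑ j ∈ Finset.range (n + 1), g j
  | 0 => by simp [runMax]
  | n + 1 => by
      simp only [runMax]
      rw [Finset.sum_range_succ]
      have h1 := runMax_le_sum g hg n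
      have h2 : 0 ≤ ∑ j ∈ Finset.range (n + 1), g j := Finset.sum_nonneg fun j _ => hg j
      have := hg (n + 1)
      exact max_le (by linarith) (by linarith)

lemma runMax_nonneg (g : ℕ → ℝ) (hg : ∀ j, 0 ≤ g j) (n : ℕ) : 0 ≤ runMax g n :=
  (hg n).trans (le_runMax g le_rfl)

lemma measurable_runMax {X : Type*} [MeasurableSpace X] (g : ℕ → X → ℝ)
    (hg : ∀ j, Measurable (g j)) : ∀ n, Measurable (fun x => runMax (fun j => g j x) n)
  | 0 => by simpa [runMax] using hg 0
  | n + 1 => by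
      simp only [runMax]
      exact (measurable_runMax g hg n).max (hg _)

lemma traj_aux (G : ℕ → ℝ) (n : ℕ) :
    runMax G n ^ 2 ≤ 2 * runMax G n * G n
      - 2 * ∑ l ∈ Finset.range n, runMax G l * (G (l + 1) - G l) := by
  induction n with
  | zero => simp [runMax]; nlinarith [sq_nonneg (G 0)]
  | succ n ih =>
    rw [Finset.sum_range_succ]
    simp only [runMax]
    rcases le_total (G (n + 1)) (runMax G n) with h | h
    · rw [max_eq_left h]; nlinarith
    · rw [max_eq_right h]; nlinarith [sq_nonneg (G (n + 1) - runMax G n)]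

lemma traj (G : ℕ → ℝ) (n : ℕ) :
    runMax G n ^ 2 ≤ 4 * G n ^ 2
      - 4 * ∑ l ∈ Finset.range n, runMax G l * (G (l + 1) - G l) := by
  have := traj_aux G n
  nlinarith [sq_nonneg (runMax G n - 2 * G n)]

lemma indep_step {Ω : Type*} [MeasurableSpace Ω] (P : Measure Ω) [IsProbabilityMeasure P]
    {C : Type*} [Fintype C] (φ : Ω → ℝ) (S W : Ω → (C → ℝ)) (hφm : Measurable φ)
    (hSm : Measurable S) (hWm : Measurable W) (hφ : ∀ ω, 0 ≤ φ ω) (hφ2 : MemLp φ 2 P)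
    (hS2 : MemLp S 2 P) (hW2 : MemLp W 2 P) (hW0 : ∫ ω, W ω ∂P = 0)
    (hind : ProbabilityTheory.IndepFun (fun ω => (φ ω, S ω)) W P) :
    0 ≤ ∫ ω, φ ω * (‖S ω + W ω‖ - ‖S ω‖) ∂P := by
  have hX : Measurable (fun ω => (φ ω, S ω)) := hφm.prodMk hSm
  have hmap := (ProbabilityTheory.indepFun_iff_map_prod_eq_prod_map_map
    hX.aemeasurable hWm.aemeasurable).1 hind
  let F : (ℝ × (C → ℝ)) × (C → ℝ) → ℝ := fun z => z.1.1 * (‖z.1.2 + z.2‖ - ‖z.1.2‖)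
  have hF : Measurable F := by fun_prop
  have hint : Integrable (fun ω => φ ω * (‖S ω + W ω‖ - ‖S ω‖)) P :=
    hφ2.integrable_mul ((hS2.add hW2).norm.sub hS2.norm)
  have hXW : Measurable (fun ω => ((φ ω, S ω), W ω)) := hX.prodMk hWm
  have e1 : ∫ ω, φ ω * (‖S ω + W ω‖ - ‖S ω‖) ∂P
      = ∫ z, F z ∂(P.map (fun ω => ((φ ω, S ω), W ω))) := by
    rw [integral_map hXW.aemeasurable hF.aestronglyMeasurable]
  have hFi : Integrable F (P.map (fun ω => ((φ ω, S ω), W ω))) := by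
    rw [integrable_map_measure hF.aestronglyMeasurable hXW.aemeasurable]
    exact hint
  have : IsProbabilityMeasure (P.map W) := Measure.isProbabilityMeasure_map hWm.aemeasurable
  have : IsProbabilityMeasure (P.map (fun ω => (φ ω, S ω))) :=
    Measure.isProbabilityMeasure_map hX.aemeasurable
  rw [e1, hmap]
  rw [hmap] at hFi
  rw [integral_prod _ hFi]
  have hpos : ∀ᵐ x ∂(P.map (fun ω => (φ ω, S ω))), 0 ≤ x.1 := by
    rw [ae_map_iff hX.aemeasurable (measurableSet_le measurable_const measurable_fst)]
    exact Eventually.of_forall hφ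
  apply integral_nonneg_of_ae
  filter_upwards [hpos] with x hx
  simp only [F, Pi.zero_apply]
  rw [integral_const_mul]
  apply mul_nonneg hx
  have hWi : Integrable (fun y : C → ℝ => y) (P.map W) := by
    rw [integrable_map_measure (by fun_prop) hWm.aemeasurable]
    exact hW2.integrable one_le_two
  have hWz : ∫ y, y ∂(P.map W) = 0 := by
    rw [integral_map hWm.aemeasurable (by fun_prop)]; exact hW0
  have hsum : Integrable (fun y : C → ℝ => x.2 + y) (P.map W) := (integrable_const _).add hWi
  rw [integral_sub hsum.norm (integrable_const _)]
  have h2 : ‖∫ y, (x.2 + y) ∂(P.map W)‖ ≤ ∫ y, ‖x.2 + y‖ ∂(P.map W) :=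
    norm_integral_le_integral_norm _
  rw [integral_add (integrable_const _) hWi, hWz] at h2
  simp only [integral_const, probReal_univ, one_smul, add_zero] at h2 ⊢
  linarith

lemma doob_vec {Ω : Type*} [MeasurableSpace Ω] (P : Measure Ω) [IsProbabilityMeasure P]
    {C : Type*} [Fintype C] (S : ℕ → Ω → (C → ℝ)) (hSm : ∀ l, Measurable (S l))
    (hS2 : ∀ l, MemLp (S l) 2 P)
    (hS0 : ∀ l, ∫ ω, (S (l + 1) ω - S l ω) ∂P = 0)
    (hind : ∀ l, ProbabilityTheory.IndepFun
      (fun ω => (runMax (fun j => ‖S j ω‖) l, S l ω)) (fun ω => S (l + 1) ω - S l ω) P) (n : ℕ) :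
    MemLp (fun ω => runMax (fun j => ‖S j ω‖) n) 2 P ∧
    ∫ ω, (runMax (fun j => ‖S j ω‖) n) ^ 2 ∂P ≤ 4 * ∫ ω, ‖S n ω‖ ^ 2 ∂P := by
  have hMm : ∀ l, Measurable (fun ω => runMax (fun j => ‖S j ω‖) l) :=
    measurable_runMax _ (fun j => (hSm j).norm)
  have hM0 : ∀ l ω, 0 ≤ runMax (fun j => ‖S j ω‖) l := fun l ω =>
    runMax_nonneg _ (fun j => norm_nonneg _) l
  have hM2 : ∀ l, MemLp (fun ω => runMax (fun j => ‖S j ω‖) l) 2 P := by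
    intro l
    have : MemLp (fun ω => ∑ j ∈ Finset.range (l + 1), ‖S j ω‖) 2 P :=
      memLp_finsetSum _ (fun j _ => (hS2 j).norm)
    refine this.mono (hMm l).aestronglyMeasurable (Eventually.of_forall fun ω => ?_)
    rw [Real.norm_of_nonneg (hM0 l ω), Real.norm_of_nonneg
      (Finset.sum_nonneg fun j _ => norm_nonneg _)]
    exact runMax_le_sum _ (fun j => norm_nonneg _) l
  refine ⟨hM2 n, ?_⟩
  have hstep : ∀ l, 0 ≤ ∫ ω, runMax (fun j => ‖S j ω‖) l * (‖S (l + 1) ω‖ - ‖S l ω‖) ∂P := by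
    intro l
    have := indep_step P (fun ω => runMax (fun j => ‖S j ω‖) l) (S l)
      (fun ω => S (l + 1) ω - S l ω) (hMm l) (hSm l) ((hSm _).sub (hSm _)) (hM0 l) (hM2 l)
      (hS2 l) ((hS2 _).sub (hS2 _)) (hS0 l) (hind l)
    simpa using this
  have hint : ∀ l, Integrable (fun ω => runMax (fun j => ‖S j ω‖) l *
      (‖S (l + 1) ω‖ - ‖S l ω‖)) P := fun l =>
    (hM2 l).integrable_mul ((hS2 _).norm.sub (hS2 _).norm)
  have hGi : Integrable (fun ω => ‖S n ω‖ ^ 2) P := (hS2 n).norm.integrable_sq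
  calc ∫ ω, (runMax (fun j => ‖S j ω‖) n) ^ 2 ∂P
      ≤ ∫ ω, (4 * ‖S n ω‖ ^ 2 - 4 * ∑ l ∈ Finset.range n, runMax (fun j => ‖S j ω‖) l *
          (‖S (l + 1) ω‖ - ‖S l ω‖)) ∂P := by
        apply integral_mono (hM2 n).integrable_sq
        · exact (hGi.const_mul 4).sub ((integrable_finsetSum _ fun l _ => hint l).const_mul 4)
        · intro ω
          exact traj (fun j => ‖S j ω‖) n
    _ = 4 * ∫ ω, ‖S n ω‖ ^ 2 ∂P - 4 * ∑ l ∈ Finset.range n,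
          ∫ ω, runMax (fun j => ‖S j ω‖) l * (‖S (l + 1) ω‖ - ‖S l ω‖) ∂P := by
        rw [integral_sub (hGi.const_mul 4)
          ((integrable_finsetSum _ fun l _ => hint l).const_mul 4), integral_const_mul,
          integral_const_mul, integral_finsetSum _ fun l _ => hint l]
    _ ≤ _ := by
        have := Finset.sum_nonneg (s := Finset.range n) fun l _ => hstep l
        linarith

lemma indep_split {Ω : Type*} [MeasurableSpace Ω] (P : Measure Ω)
    {ι : Type*} [Fintype ι] [DecidableEq ι] (ξ : ι → Ω → ℝ) (hξ : ∀ i, Measurable (ξ i))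
    (hi : ProbabilityTheory.iIndepFun ξ P) (A : Finset ι) :
    ProbabilityTheory.IndepFun (fun ω i => if i ∈ A then ξ i ω else 0)
      (fun ω i => if i ∈ A then 0 else ξ i ω) P := by
  have h := hi.indepFun_finset A Aᶜ disjoint_compl_right hξ
  have m1 : Measurable (fun (y : A → ℝ) (i : ι) => if h : i ∈ A then y ⟨i, h⟩ else 0) := by
    refine measurable_pi_lambda _ fun i => ?_
    by_cases h : i ∈ A
    · simpa [h] using measurable_pi_apply _
    · simp [h]
  have m2 : Measurable (fun (y : (Aᶜ : Finset ι) → ℝ) (i : ι) =>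
      if h : i ∈ Aᶜ then y ⟨i, h⟩ else 0) := by
    refine measurable_pi_lambda _ fun i => ?_
    by_cases h : i ∈ A
    · simp [h]
    · simpa [h] using measurable_pi_apply _
  have h1 := h.comp m1 m2
  convert h1 using 1
  · ext ω i
    by_cases h : i ∈ A <;> simp [h]
  · ext ω i
    by_cases h : i ∈ A <;> simp [h]

/-- partial coordinates combination -/
def combC {K : Type*} [DecidableEq K] (cs : K → ℕ) (T : Finset K)
    (c : ∀ k, Fin (cs k + 1)) (k : K) : ℕ := if k ∈ T then (c k : ℕ) else cs k

/-- box sums with coordinates in `T` free -/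
noncomputable def boxS {Ω K : Type*} [Fintype K] [DecidableEq K] {ι : K → Type*}
    (C : ∀ k, ℕ → Finset (ι k)) (ξ : (∀ k, ι k) → Ω → ℝ) (cs : K → ℕ) (T : Finset K)
    (ω : Ω) (c : ∀ k, Fin (cs k + 1)) : ℝ :=
  ∑ i ∈ Fintype.piFinset (fun k => C k (combC cs T c k)), ξ i ω

lemma memLp_pi_two {Ω C : Type*} [MeasurableSpace Ω] (P : Measure Ω) [Fintype C]
    (S : Ω → (C → ℝ)) (hm : Measurable S) (h : ∀ c, MemLp (fun ω => S ω c) 2 P) :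
    MemLp S 2 P := by
  have : MemLp (fun ω => ∑ c, ‖S ω c‖) 2 P := memLp_finsetSum _ (fun c _ => (h c).norm)
  refine this.mono hm.aestronglyMeasurable (Eventually.of_forall fun ω => ?_)
  have h0 : 0 ≤ ∑ c, ‖S ω c‖ := Finset.sum_nonneg fun c _ => norm_nonneg _
  rw [Real.norm_of_nonneg h0, pi_norm_le_iff_of_nonneg h0]
  intro c
  exact Finset.single_le_sum (f := fun c => ‖S ω c‖) (fun c _ => norm_nonneg _)
    (Finset.mem_univ c)

lemma boxS_step {Ω : Type*} [MeasurableSpace Ω] (P : Measure Ω) [IsProbabilityMeasure P]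
    {K : Type*} [Fintype K] [DecidableEq K] {ι : K → Type*} [∀ k, Fintype (ι k)]
    [∀ k, DecidableEq (ι k)] (ξ : (∀ k, ι k) → Ω → ℝ) (hξ : ∀ i, Measurable (ξ i))
    (hi : ProbabilityTheory.iIndepFun ξ P) (h2 : ∀ i, MemLp (ξ i) 2 P)
    (h0 : ∀ i, ∫ ω, ξ i ω ∂P = 0) (C : ∀ k, ℕ → Finset (ι k)) (hC : ∀ k, Monotone (C k))
    (cs : K → ℕ) (T : Finset K) (k : K) (hk : k ∉ T) :
    MemLp (boxS C ξ cs (insert k T)) 2 P ∧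
    ∫ ω, ‖boxS C ξ cs (insert k T) ω‖ ^ 2 ∂P ≤ 4 * ∫ ω, ‖boxS C ξ cs T ω‖ ^ 2 ∂P := by
  let B : ℕ → (∀ k, Fin (cs k + 1)) → Finset (∀ k, ι k) := fun l c =>
    Fintype.piFinset (Function.update (fun k => C k (combC cs T c k)) k (C k l))
  have hB : ∀ l c i, i ∈ B l c ↔ i k ∈ C k l ∧ ∀ k', k' ≠ k → i k' ∈ C k' (combC cs T c k') := by
    intro l c i
    simp only [B, Fintype.mem_piFinset]
    constructor
    · intro h
      refine ⟨by simpa using h k, fun k' hk' => ?_⟩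
      have := h k'
      rwa [Function.update_of_ne hk'] at this
    · rintro ⟨h1, h2⟩ k'
      by_cases hk' : k' = k
      · subst hk'; simpa using h1
      · rw [Function.update_of_ne hk']; exact h2 k' hk'
  let F : ℕ → ((∀ k, ι k) → ℝ) → ((∀ k, Fin (cs k + 1)) → ℝ) := fun l y c => ∑ i ∈ B l c, y i
  have hFm : ∀ l, Measurable (F l) := fun l => by
    refine measurable_pi_lambda _ fun c => ?_
    exact Finset.measurable_sum _ fun i _ => measurable_pi_apply i
  let S : ℕ → Ω → ((∀ k, Fin (cs k + 1)) → ℝ) := fun l ω => F l (fun i => ξ i ω)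
  have hSm : ∀ l, Measurable (S l) := fun l => (hFm l).comp (measurable_pi_lambda _ hξ)
  have hS2 : ∀ l, MemLp (S l) 2 P := fun l =>
    memLp_pi_two P _ (hSm l) fun c => memLp_finsetSum _ fun i _ => h2 i
  have hSi : ∀ l, ∫ ω, S l ω ∂P = 0 := by
    intro l
    ext c
    rw [eval_integral (fun c => ?_)]
    · simp only [S, F, Pi.zero_apply]
      rw [integral_finsetSum _ fun i _ => (h2 i).integrable one_le_two]
      exact Finset.sum_eq_zero fun i _ => h0 i
    · exact (memLp_finsetSum _ fun i _ => h2 i).integrable one_le_two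
  have hS0 : ∀ l, ∫ ω, (S (l + 1) ω - S l ω) ∂P = 0 := by
    intro l
    rw [integral_sub ((hS2 _).integrable one_le_two) ((hS2 _).integrable one_le_two), hSi, hSi,
      sub_zero]
  have hind : ∀ l, ProbabilityTheory.IndepFun
      (fun ω => (runMax (fun j => ‖S j ω‖) l, S l ω)) (fun ω => S (l + 1) ω - S l ω) P := by
    intro l
    let A : Finset (∀ k, ι k) := Finset.univ.filter fun i => i k ∈ C k l
    have hA : ∀ i, i ∈ A ↔ i k ∈ C k l := fun i => by simp [A]
    have h := indep_split P ξ hξ hi A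
    have m1 : Measurable (fun y : (∀ k, ι k) → ℝ => (runMax (fun j => ‖F j y‖) l, F l y)) :=
      (measurable_runMax _ (fun j => (hFm j).norm) l).prodMk (hFm l)
    have h1 := h.comp m1 (hFm (l + 1))
    have e1 : ∀ ω j, j ≤ l → F j (fun i => if i ∈ A then ξ i ω else 0) = S j ω := by
      intro ω j hj
      ext c
      simp only [S, F]
      refine Finset.sum_congr rfl fun i hi => ?_
      rw [if_pos]
      rw [hA]
      exact hC k hj ((hB _ _ _).1 hi).1
    have e2 : ∀ ω, F (l + 1) (fun i => if i ∈ A then 0 else ξ i ω) = S (l + 1) ω - S l ω := by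
      intro ω
      ext c
      simp only [S, F, Pi.sub_apply]
      rw [eq_sub_iff_add_eq]
      have : ∑ i ∈ B l c, ξ i ω = ∑ i ∈ B (l + 1) c, if i ∈ A then ξ i ω else 0 := by
        rw [← Finset.sum_filter]
        apply Finset.sum_congr _ fun _ _ => rfl
        ext i
        rw [Finset.mem_filter, hB, hB, hA]
        constructor
        · rintro ⟨a, b⟩
          exact ⟨⟨hC k (Nat.le_succ l) a, b⟩, a⟩
        · rintro ⟨⟨_, b⟩, a⟩
          exact ⟨a, b⟩
      rw [this, ← Finset.sum_add_distrib]
      refine Finset.sum_congr rfl fun i _ => ?_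
      by_cases h : i ∈ A <;> simp [h]
    convert h1 using 1
    · ext ω : 1
      simp only [Function.comp]
      rw [e1 ω l le_rfl]
      congr 1
      refine runMax_congr fun j hj => ?_
      rw [e1 ω j hj]
    · ext ω : 1
      simp only [Function.comp]
      rw [e2 ω]
  obtain ⟨hM, hD⟩ := doob_vec P S hSm hS2 hS0 hind (cs k)
  have hT : boxS C ξ cs T = S (cs k) := by
    ext ω c
    simp only [boxS, S, F]
    apply Finset.sum_congr _ fun _ _ => rfl
    simp only [B]
    congr 1
    ext k' : 1
    by_cases hk' : k' = k
    · subst hk'; simp [combC, hk]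
    · rw [Function.update_of_ne hk']
  have hI : ∀ ω, ‖boxS C ξ cs (insert k T) ω‖ ≤ runMax (fun j => ‖S j ω‖) (cs k) := by
    intro ω
    rw [pi_norm_le_iff_of_nonneg (runMax_nonneg _ (fun j => norm_nonneg _) _)]
    intro c
    have : boxS C ξ cs (insert k T) ω c = S (c k) ω c := by
      simp only [boxS, S, F]
      apply Finset.sum_congr _ fun _ _ => rfl
      simp only [B]
      congr 1
      ext k' : 1
      by_cases hk' : k' = k
      · subst hk'; simp [combC]
      · rw [Function.update_of_ne hk']; simp [combC, hk']
    rw [this]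
    exact (norm_le_pi_norm _ c).trans
      (le_runMax (fun j => ‖S j ω‖) (Nat.lt_succ_iff.1 (c k).2))
  have hIm : MemLp (boxS C ξ cs (insert k T)) 2 P := by
    refine memLp_pi_two P _ ?_ fun c => memLp_finsetSum _ fun i _ => h2 i
    exact measurable_pi_lambda _ fun c => Finset.measurable_sum _ fun i _ => hξ i
  refine ⟨hIm, ?_⟩
  rw [hT]
  refine le_trans ?_ hD
  apply integral_mono hIm.norm.integrable_sq hM.integrable_sq
  intro ω
  exact pow_le_pow_left₀ (norm_nonneg _) (hI ω) 2

lemma cairoli {Ω : Type*} [MeasurableSpace Ω] (P : Measure Ω) [IsProbabilityMeasure P]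
    {K : Type*} [Fintype K] [DecidableEq K] {ι : K → Type*} [∀ k, Fintype (ι k)]
    [∀ k, DecidableEq (ι k)] (ξ : (∀ k, ι k) → Ω → ℝ) (hξ : ∀ i, Measurable (ξ i))
    (hi : ProbabilityTheory.iIndepFun ξ P) (h2 : ∀ i, MemLp (ξ i) 2 P)
    (h0 : ∀ i, ∫ ω, ξ i ω ∂P = 0) (σ : ℝ) (hσ : ∀ i, ∫ ω, ξ i ω ^ 2 ∂P = σ ^ 2)
    (C : ∀ k, ℕ → Finset (ι k)) (hC : ∀ k, Monotone (C k))
    (cs : K → ℕ) (T : Finset K) :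
    MemLp (boxS C ξ cs T) 2 P ∧
    ∫ ω, ‖boxS C ξ cs T ω‖ ^ 2 ∂P ≤ 4 ^ T.card * (σ ^ 2 * ∏ k, ((C k (cs k)).card : ℝ)) := by
  induction T using Finset.induction_on with
  | empty =>
    refine ⟨?_, ?_⟩
    · refine memLp_pi_two P _ ?_ fun c => memLp_finsetSum _ fun i _ => h2 i
      exact measurable_pi_lambda _ fun c => Finset.measurable_sum _ fun i _ => hξ i
    · have hn : ∀ ω, ‖boxS C ξ cs ∅ ω‖ ^ 2
          = (∑ i ∈ Fintype.piFinset (fun k => C k (cs k)), ξ i ω) ^ 2 := by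
        intro ω
        have : boxS C ξ cs ∅ ω = fun _ =>
            ∑ i ∈ Fintype.piFinset (fun k => C k (cs k)), ξ i ω := by
          ext c; simp [boxS, combC]
        rw [this, pi_norm_const]
        simp
      simp_rw [hn]
      have hv := ProbabilityTheory.IndepFun.variance_sum (μ := P) (X := ξ)
        (s := Fintype.piFinset (fun k => C k (cs k))) (fun i _ => h2 i)
        (fun i _ j _ hij => hi.indepFun hij)
      have e : ∀ i, ProbabilityTheory.variance (ξ i) P = σ ^ 2 := by
        intro i
        rw [ProbabilityTheory.variance_of_integral_eq_zero (hξ i).aemeasurable (h0 i), hσ i]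
      rw [ProbabilityTheory.variance_of_integral_eq_zero] at hv
      · simp only [Finset.sum_apply] at hv
        rw [hv]
        simp [e, Fintype.card_piFinset]
        rw [mul_comm]
      · exact (memLp_finsetSum' _ fun i _ => h2 i).1.aemeasurable
      · simp only [Finset.sum_apply]
        rw [integral_finsetSum _ fun i _ => (h2 i).integrable one_le_two]
        exact Finset.sum_eq_zero fun i _ => h0 i
  | insert k T hk ih =>
    obtain ⟨h3, h4⟩ := boxS_step P ξ hξ hi h2 h0 C hC cs T k hk
    refine ⟨h3, h4.trans ?_⟩
    rw [Finset.card_insert_of_notMem hk, pow_succ]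
    nlinarith [ih.2]

lemma alg_aux (a b p n t : ℝ) (ht : t ≠ 0) :
    a * (b * (p * n ^ 2)) = a * b / t ^ 2 * p * (t * n) ^ 2 := by
  field_simp

lemma alg_aux2 (a s t m : ℝ) : a * s / t ^ 2 * (a / m) = a * a * s / (t ^ 2 * m) := by
  rw [div_mul_div_comm]; ring

lemma alg_aux3 (m : ℝ) (hm : m ≠ 0) (j : ℕ) :
    (2 : ℝ) ^ (j + 1) * m = 2 / m * (1 / 2 : ℝ) ^ j * (2 ^ j * m) ^ 2 := by
  rw [one_div, inv_pow]
  field_simp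
  ring

lemma shell_bound {Ω : Type*} [MeasurableSpace Ω] (P : Measure Ω) [IsProbabilityMeasure P]
    {K : Type*} [Fintype K] [DecidableEq K] {ι : K → Type*} [∀ k, Fintype (ι k)]
    [∀ k, DecidableEq (ι k)] (ξ : (∀ k, ι k) → Ω → ℝ) (hξ : ∀ i, Measurable (ξ i))
    (hi : ProbabilityTheory.iIndepFun ξ P) (h2 : ∀ i, MemLp (ξ i) 2 P)
    (h0 : ∀ i, ∫ ω, ξ i ω ∂P = 0) (σ : ℝ) (hσ : ∀ i, ∫ ω, ξ i ω ^ 2 ∂P = σ ^ 2)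
    (C : ∀ k, ℕ → Finset (ι k)) (hC : ∀ k, Monotone (C k))
    (cs : K → ℕ) (t : ℝ) (ht : 0 < t) :
    P {ω | ∃ c : K → ℕ, (∀ k, c k ≤ cs k) ∧
        t < |∑ i ∈ Fintype.piFinset (fun k => C k (c k)), ξ i ω|} ≤
      ENNReal.ofReal (4 ^ Fintype.card K * (σ ^ 2 * ∏ k, ((C k (cs k)).card : ℝ)) / t ^ 2) := by
  obtain ⟨hm, hb⟩ := cairoli P ξ hξ hi h2 h0 σ hσ C hC cs Finset.univ
  have hsub : {ω | ∃ c : K → ℕ, (∀ k, c k ≤ cs k) ∧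
        t < |∑ i ∈ Fintype.piFinset (fun k => C k (c k)), ξ i ω|} ⊆
      {ω | t ^ 2 ≤ ‖boxS C ξ cs Finset.univ ω‖ ^ 2} := by
    rintro ω ⟨c, hc, hlt⟩
    have h1 := norm_le_pi_norm (boxS C ξ cs Finset.univ ω)
      (fun k => ⟨c k, Nat.lt_succ_of_le (hc k)⟩)
    simp only [boxS, combC, Finset.mem_univ, if_true, Real.norm_eq_abs] at h1
    exact pow_le_pow_left₀ ht.le (hlt.le.trans h1) 2
  refine (measure_mono hsub).trans ?_
  have hmk := mul_meas_ge_le_integral_of_nonneg (μ := P)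
    (f := fun ω => ‖boxS C ξ cs Finset.univ ω‖ ^ 2)
    (Eventually.of_forall fun ω => sq_nonneg _) hm.norm.integrable_sq (t ^ 2)
  rw [ENNReal.le_ofReal_iff_toReal_le (measure_ne_top _ _) (by positivity), le_div_iff₀' (by positivity)]
  exact hmk.trans hb

set_option maxHeartbeats 800000 in
lemma noise_bound {Ω : Type*} [MeasurableSpace Ω] (P : Measure Ω) [IsProbabilityMeasure P]
    {K : Type*} [Fintype K] [DecidableEq K] {ι : K → Type*} [∀ k, Fintype (ι k)]
    [∀ k, DecidableEq (ι k)] (ξ : (∀ k, ι k) → Ω → ℝ) (hξ : ∀ i, Measurable (ξ i))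
    (hi : ProbabilityTheory.iIndepFun ξ P) (h2 : ∀ i, MemLp (ξ i) 2 P)
    (h0 : ∀ i, ∫ ω, ξ i ω ∂P = 0) (σ : ℝ) (hσ : ∀ i, ∫ ω, ξ i ω ^ 2 ∂P = σ ^ 2)
    (C : ∀ k, ℕ → Finset (ι k)) (hC : ∀ k, Monotone (C k)) (hC0 : ∀ k, 0 < (C k 0).card)
    (cm : K → ℕ) (t : ℝ) (ht : 0 < t) :
    P {ω | ∃ c : K → ℕ, (∀ k, c k ≤ cm k) ∧
        t * ∏ k, ((C k (c k)).card : ℝ) < |∑ i ∈ Fintype.piFinset (fun k => C k (c k)), ξ i ω|} ≤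
      ENNReal.ofReal (16 ^ Fintype.card K * σ ^ 2 / (t ^ 2 * ∏ k, ((C k 0).card : ℝ))) := by
  set m : K → ℕ := fun k => (C k 0).card with hmdef
  let J : K → ℕ := fun k => Fintype.card (ι k) + 1
  let cs : (K → ℕ) → K → ℕ := fun j k =>
    Nat.findGreatest (fun c => (C k c).card < 2 ^ (j k + 1) * m k) (cm k)
  let N : (K → ℕ) → ℝ := fun j => ∏ k, ((2 : ℝ) ^ (j k) * m k)
  have hmpos : ∀ k, (0 : ℝ) < m k := fun k => by exact_mod_cast hC0 k
  have hN : ∀ j, 0 < N j := fun j => Finset.prod_pos fun k _ => mul_pos (by positivity) (hmpos k)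
  have hsub : {ω | ∃ c : K → ℕ, (∀ k, c k ≤ cm k) ∧
        t * ∏ k, ((C k (c k)).card : ℝ) < |∑ i ∈ Fintype.piFinset (fun k => C k (c k)), ξ i ω|} ⊆
      ⋃ j ∈ Fintype.piFinset (fun k => Finset.range (J k)), {ω | ∃ c : K → ℕ, (∀ k, c k ≤ cs j k) ∧
        t * N j < |∑ i ∈ Fintype.piFinset (fun k => C k (c k)), ξ i ω|} := by
    rintro ω ⟨c, hc, hlt⟩
    have hcard : ∀ k, m k ≤ (C k (c k)).card := fun k =>
      Finset.card_le_card (hC k (Nat.zero_le _))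
    let j : K → ℕ := fun k => Nat.log 2 ((C k (c k)).card / m k)
    have hj1 : ∀ k, 2 ^ (j k) * m k ≤ (C k (c k)).card := fun k => by
      have h1 : (C k (c k)).card / m k ≠ 0 := (Nat.div_pos (hcard k) (hC0 k)).ne'
      have := Nat.pow_log_le_self 2 h1
      exact (Nat.le_div_iff_mul_le (hC0 k)).1 this
    have hj2 : ∀ k, (C k (c k)).card < 2 ^ (j k + 1) * m k := fun k => by
      have := Nat.lt_pow_succ_log_self (b := 2) (by norm_num) ((C k (c k)).card / m k)
      exact (Nat.div_lt_iff_lt_mul (hC0 k)).1 this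
    simp only [Set.mem_iUnion, Set.mem_ofPred_eq]
    refine ⟨j, ?_, c, fun k => Nat.le_findGreatest (hc k) (hj2 k), ?_⟩
    · rw [Fintype.mem_piFinset]
      intro k
      rw [Finset.mem_range]
      have h3 : j k < 2 ^ (j k) := Nat.lt_two_pow_self
      have h4 : 2 ^ j k ≤ 2 ^ j k * m k := Nat.le_mul_of_pos_right _ (hC0 k)
      have h5 : (C k (c k)).card ≤ Fintype.card (ι k) := Finset.card_le_univ _
      have := hj1 k
      simp only [J]
      omega
    · refine lt_of_le_of_lt ?_ hlt
      refine mul_le_mul_of_nonneg_left ?_ ht.le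
      refine Finset.prod_le_prod (fun k _ => (mul_pos (by positivity) (hmpos k)).le) fun k _ => ?_
      exact_mod_cast hj1 k
  refine (measure_mono hsub).trans ((measure_biUnion_finset_le _ _).trans ?_)
  have hterm : ∀ j ∈ Fintype.piFinset (fun k => Finset.range (J k)),
      P {ω | ∃ c : K → ℕ, (∀ k, c k ≤ cs j k) ∧
        t * N j < |∑ i ∈ Fintype.piFinset (fun k => C k (c k)), ξ i ω|} ≤
      ENNReal.ofReal (4 ^ Fintype.card K * σ ^ 2 / t ^ 2 * ∏ k, (2 / m k * (1 / 2 : ℝ) ^ (j k))) := by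
    intro j _
    refine (shell_bound P ξ hξ hi h2 h0 σ hσ C hC (cs j) (t * N j) (mul_pos ht (hN j))).trans ?_
    apply ENNReal.ofReal_le_ofReal
    have hcs : ∀ k, ((C k (cs j k)).card : ℝ) ≤ 2 ^ (j k + 1) * m k := fun k => by
      have := Nat.findGreatest_spec (P := fun c => (C k c).card < 2 ^ (j k + 1) * m k)
        (Nat.zero_le (cm k)) (by
          have : 1 < 2 ^ (j k + 1) := Nat.one_lt_two_pow (by omega)
          have := hC0 k
          change m k < _
          nlinarith)
      exact_mod_cast this.le
    have hprod : ∏ k, ((C k (cs j k)).card : ℝ) ≤ ∏ k, ((2 : ℝ) ^ (j k + 1) * m k) :=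
      Finset.prod_le_prod (fun k _ => by positivity) fun k _ => hcs k
    have hid : ∏ k, ((2 : ℝ) ^ (j k + 1) * m k) = (∏ k, (2 / m k * (1 / 2 : ℝ) ^ (j k))) * N j ^ 2 := by
      simp only [N]
      rw [← Finset.prod_pow, ← Finset.prod_mul_distrib]
      refine Finset.prod_congr rfl fun k _ => ?_
      exact alg_aux3 _ (hmpos k).ne' _
    have hNj := hN j
    rw [div_le_iff₀ (pow_pos (mul_pos ht hNj) 2)]
    calc 4 ^ Fintype.card K * (σ ^ 2 * ∏ k, ((C k (cs j k)).card : ℝ))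
        ≤ 4 ^ Fintype.card K * (σ ^ 2 * ((∏ k, (2 / m k * (1 / 2 : ℝ) ^ (j k))) * N j ^ 2)) := by
          rw [← hid]; gcongr
      _ = _ := alg_aux _ _ _ _ _ ht.ne'
  refine (Finset.sum_le_sum hterm).trans ?_
  have hnn : ∀ j : K → ℕ, 0 ≤ ∏ k, (2 / (m k : ℝ) * (1 / 2 : ℝ) ^ (j k)) := fun j =>
    Finset.prod_nonneg fun k _ => by positivity
  rw [← ENNReal.ofReal_sum_of_nonneg (fun j _ => mul_nonneg (by positivity) (hnn j))]
  apply ENNReal.ofReal_le_ofReal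
  rw [← Finset.mul_sum, ← Finset.prod_univ_sum (fun k => Finset.range (J k))
    (fun k (x : ℕ) => 2 / (m k : ℝ) * (1 / 2 : ℝ) ^ x)]
  have hgeo : ∀ k, ∑ x ∈ Finset.range (J k), 2 / (m k : ℝ) * (1 / 2 : ℝ) ^ x ≤ 4 / m k := by
    intro k
    rw [← Finset.mul_sum]
    have h1 : ∑ x ∈ Finset.range (J k), (1 / 2 : ℝ) ^ x ≤ 2 := by
      simpa using sum_geometric_two_le (J k)
    calc 2 / (m k : ℝ) * ∑ x ∈ Finset.range (J k), (1 / 2 : ℝ) ^ x ≤ 2 / (m k : ℝ) * 2 := by gcongr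
      _ = _ := by ring
  have hp : ∏ k, ∑ x ∈ Finset.range (J k), 2 / (m k : ℝ) * (1 / 2 : ℝ) ^ x ≤ ∏ k, (4 / (m k : ℝ)) :=
    Finset.prod_le_prod (fun k _ => Finset.sum_nonneg fun x _ => by positivity) fun k _ => hgeo k
  have hq : ∏ k, (4 / (m k : ℝ)) = 4 ^ Fintype.card K / ∏ k, (m k : ℝ) := by
    rw [Finset.prod_div_distrib]; simp
  have hmp : 0 < ∏ k, (m k : ℝ) := Finset.prod_pos fun k _ => hmpos k
  calc _ ≤ 4 ^ Fintype.card K * σ ^ 2 / t ^ 2 * (4 ^ Fintype.card K / ∏ k, (m k : ℝ)) := by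
        rw [← hq]; gcongr
    _ = _ := by
        have : (16 : ℝ) ^ Fintype.card K = 4 ^ Fintype.card K * 4 ^ Fintype.card K := by
          rw [← mul_pow]; norm_num
        rw [this]
        exact alg_aux2 _ _ _ _

lemma extrap (p : Polynomial ℝ) (m : ℕ) (hp : p.natDegree ≤ m) (B : ℝ)
    (hB : ∀ i : ℕ, i ≤ m → |p.eval (-(i : ℝ))| ≤ B) : |p.eval 1| ≤ 2 ^ (m + 1) * B := by
  have h1 := congrFun (Polynomial.fwdDiff_iter_eq_zero_of_degree_lt (P := p) (n := m + 1)
    (by omega)) (-(m : ℝ))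
  rw [fwdDiff_iter_eq_sum_shift, Pi.zero_apply] at h1
  have hB0 : 0 ≤ B := (abs_nonneg _).trans (hB 0 (Nat.zero_le _))
  rw [Finset.sum_range_succ] at h1
  have e : p.eval 1 = - ∑ k ∈ Finset.range (m + 1),
      ((-1 : ℤ) ^ (m + 1 - k) * ((m + 1).choose k : ℤ)) • p.eval (-(m : ℝ) + k • (1 : ℝ)) := by
    rw [eq_neg_iff_add_eq_zero, add_comm]
    convert h1 using 2
    simp
  rw [e, abs_neg]
  calc _ ≤ ∑ k ∈ Finset.range (m + 1), ((m + 1).choose k : ℝ) * B := by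
        refine (Finset.abs_sum_le_sum_abs _ _).trans (Finset.sum_le_sum fun k hk => ?_)
        rw [Finset.mem_range] at hk
        rw [zsmul_eq_mul, abs_mul]
        push_cast
        rw [abs_mul, abs_pow, abs_neg, abs_one, one_pow, one_mul, Nat.abs_cast]
        refine mul_le_mul_of_nonneg_left ?_ (Nat.cast_nonneg _)
        have := hB (m - k) (Nat.sub_le _ _)
        rw [Nat.cast_sub (by omega)] at this
        have e2 : -(m : ℝ) + k • (1 : ℝ) = -((m : ℝ) - k) := by
          rw [nsmul_eq_mul]; ring
        rw [e2]
        exact this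
    _ ≤ ∑ k ∈ Finset.range (m + 1 + 1), ((m + 1).choose k : ℝ) * B := by
        rw [Finset.sum_range_succ _ (m + 1)]
        have : 0 ≤ ((m + 1).choose (m + 1) : ℝ) * B := by positivity
        linarith
    _ = _ := by
        rw [← Finset.sum_mul]
        congr 1
        exact_mod_cast Nat.sum_range_choose (m + 1)

lemma foldr_pderiv (d : ℕ) (j : Fin d → ℕ) (f : (Fin d → ℝ) → ℝ) (k : Fin d)
    (hj : ∀ k', k' ≠ k → j k' = 0) : ∀ l : List (Fin d), l.Nodup →
    l.foldr (fun k g => pderivIter d k (j k) g) f = if k ∈ l then pderivIter d k (j k) f else f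
  | [], _ => by simp
  | a :: l, h => by
      rw [List.nodup_cons] at h
      rw [List.foldr_cons, foldr_pderiv d j f k hj l h.2]
      by_cases ha : a = k
      · subst ha
        simp [h.1]
      · rw [hj a ha]
        have : k ≠ a := fun h => ha h.symm
        simp [pderivIter, this]

lemma mixed_single (d : ℕ) (j : Fin d → ℕ) (f : (Fin d → ℝ) → ℝ) (k : Fin d)
    (hj : ∀ k', k' ≠ k → j k' = 0) : mixedPDeriv d j f = pderivIter d k (j k) f := by
  rw [mixedPDeriv, foldr_pderiv d j f k hj _ (List.nodup_finRange d)]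
  simp

lemma mixed_zero (d : ℕ) (f : (Fin d → ℝ) → ℝ) (k : Fin d) :
    mixedPDeriv d (fun _ => 0) f = f := by
  rw [mixed_single d _ f k (fun _ _ => rfl)]; simp [pderivIter]

lemma taylor_congr (d s : ℕ) (α : Fin d → ℕ) (f : (Fin d → ℝ) → ℝ) (x₀ x y : Fin d → ℝ)
    (h : ∀ k : Fin d, (k : ℕ) < s → x k = y k) :
    taylorJ0 d s α f x₀ x = taylorJ0 d s α f x₀ y := by
  unfold taylorJ0
  refine Finset.sum_congr rfl fun j _ => ?_
  split_ifs with hj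
  · congr 1
    refine Finset.prod_congr rfl fun k _ => ?_
    rcases lt_or_ge (k : ℕ) s with hk | hk
    · rw [h k hk]
    · rw [hj.1 k hk]; simp
  · rfl

lemma taylor_axis (d s : ℕ) (α : Fin d → ℕ) (f : (Fin d → ℝ) → ℝ) (x₀ : Fin d → ℝ) (k : Fin d)
    (hα : 1 ≤ α k) (hks : (k : ℕ) < s)
    (h0 : ∀ j : ℕ, 1 ≤ j → j ≤ α k - 1 → pderivIter d k j f x₀ = 0) :
    ∃ A : ℝ, 0 ≤ A ∧ ∀ h : ℝ, |taylorJ0 d s α f x₀ (Function.update x₀ k (x₀ k + h)) - f x₀|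
      ≤ A * |h| ^ (α k) := by
  let j1 : ∀ k : Fin d, Fin (α k + 1) := Function.update (fun _ => 0) k (Fin.last _)
  have hj1k : (j1 k : ℕ) = α k := by simp [j1]
  refine ⟨|mixedPDeriv d (fun k => (j1 k : ℕ)) f x₀ /
    ∏ k : Fin d, (Nat.factorial (j1 k : ℕ) : ℝ)|, abs_nonneg _, fun h => ?_⟩
  have hne : (fun _ => 0 : ∀ k : Fin d, Fin (α k + 1)) ≠ j1 := by
    intro he
    have := congrArg (fun j => ((j k : Fin (α k + 1)) : ℕ)) he
    simp only [hj1k] at this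
    simp at this
    omega
  have hprod : ∀ j : ∀ k : Fin d, Fin (α k + 1), (∀ k', k' ≠ k → (j k' : ℕ) = 0) →
      ∏ k' : Fin d, (Function.update x₀ k (x₀ k + h) k' - x₀ k') ^ ((j k' : ℕ)) = h ^ (j k : ℕ) := by
    intro j hj
    rw [Finset.prod_eq_single k]
    · simp
    · intro k' _ hk'
      rw [hj k' hk', pow_zero]
    · simp
  rw [taylorJ0, Fintype.sum_eq_add _ _ hne]
  · have e0 : (∑ k : Fin d, if (k : ℕ) < s then (((0 : Fin (α k + 1)) : ℕ) : ℝ) / (α k : ℝ) else 0)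
        ≤ 1 := by simp
    rw [if_pos ⟨fun k _ => by simp, e0⟩, hprod _ (by simp)]
    have hm : mixedPDeriv d (fun k => (((0 : Fin (α k + 1)) : ℕ))) f = f := by
      simpa using mixed_zero d f k
    rw [hm]
    have : f x₀ / ∏ k : Fin d, (Nat.factorial (((0 : Fin (α k + 1)) : ℕ)) : ℝ) = f x₀ := by simp
    rw [this]
    have h1 : ∀ k', k' ≠ k → (j1 k' : ℕ) = 0 := fun k' hk' => by simp [j1, hk']
    rw [hprod j1 h1, hj1k]
    simp only [Fin.val_zero, pow_zero, mul_one, add_sub_cancel_left]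
    split_ifs
    · rw [abs_mul, abs_pow]
    · rw [abs_zero]; positivity
  · rintro j ⟨hj0, hj1⟩
    split_ifs with hj
    · by_cases hs : ∀ k', k' ≠ k → (j k' : ℕ) = 0
      · rw [mixed_single d _ f k hs]
        have hjk : 1 ≤ (j k : ℕ) := by
          by_contra hcon
          apply hj0
          ext k'
          by_cases hk' : k' = k
          · subst hk'
            have h3 : (j k' : ℕ) = 0 := by omega
            simpa using h3
          · simpa using hs k' hk'
        have hjk2 : (j k : ℕ) ≤ α k - 1 := by
          by_contra hcon
          apply hj1
          ext k'
          by_cases hk' : k' = k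
          · subst hk'
            rw [hj1k]
            have := (j k').2
            omega
          · simpa [j1, hk'] using hs k' hk'
        rw [h0 _ hjk hjk2]; simp
      · push Not at hs
        obtain ⟨k', hk', hne'⟩ := hs
        have hz : ∏ k' : Fin d, (Function.update x₀ k (x₀ k + h) k' - x₀ k') ^ ((j k' : ℕ)) = 0 := by
          apply Finset.prod_eq_zero (Finset.mem_univ k')
          rw [Function.update_of_ne hk', sub_self]
          exact zero_pow hne'
        rw [hz, mul_zero]
    · rfl

lemma taylor_poly (d s : ℕ) (α : Fin d → ℕ) (f : (Fin d → ℝ) → ℝ) (x₀ y : Fin d → ℝ) (k : Fin d)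
    (h b : ℝ) : ∃ p : Polynomial ℝ, p.natDegree ≤ α k ∧ ∀ t : ℝ,
      p.eval t = taylorJ0 d s α f x₀ (Function.update y k (x₀ k + h * t)) - b := by
  let p : Polynomial ℝ := (∑ j : (∀ k : Fin d, Fin (α k + 1)),
    if (∀ k : Fin d, s ≤ (k : ℕ) → (j k : ℕ) = 0) ∧
        (∑ k : Fin d, if (k : ℕ) < s then ((j k : ℕ) : ℝ) / (α k : ℝ) else 0) ≤ 1 then
      Polynomial.C ((mixedPDeriv d (fun k => (j k : ℕ)) f x₀ /
          ∏ k : Fin d, (Nat.factorial (j k : ℕ) : ℝ)) *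
        (∏ k' ∈ Finset.univ.erase k, (y k' - x₀ k') ^ ((j k' : ℕ))) * h ^ (j k : ℕ)) *
        Polynomial.X ^ (j k : ℕ)
    else 0) - Polynomial.C b
  refine ⟨p, ?_, fun t => ?_⟩
  · refine (Polynomial.natDegree_sub_le _ _).trans (max_le ?_ (by simp))
    refine Polynomial.natDegree_sum_le_of_forall_le _ _ fun j _ => ?_
    split_ifs
    · exact (Polynomial.natDegree_C_mul_X_pow_le _ _).trans (Nat.lt_succ_iff.1 (j k).2)
    · simp
  · simp only [p, taylorJ0, Polynomial.eval_sub, Polynomial.eval_C, Polynomial.eval_finsetSum]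
    congr 1
    refine Finset.sum_congr rfl fun j _ => ?_
    split_ifs
    · have : ∏ k' ∈ Finset.univ.erase k, (Function.update y k (x₀ k + h * t) k' - x₀ k') ^ (j k' : ℕ)
          = ∏ k' ∈ Finset.univ.erase k, (y k' - x₀ k') ^ (j k' : ℕ) := by
        refine Finset.prod_congr rfl fun k' hk' => ?_
        rw [Function.update_of_ne (Finset.ne_of_mem_erase hk')]
      rw [← Finset.mul_prod_erase _ (fun k' => (Function.update y k (x₀ k + h * t) k' - x₀ k') ^ (j k' : ℕ))
        (Finset.mem_univ k), this]
      simp only [Polynomial.eval_mul, Polynomial.eval_C, Polynomial.eval_pow, Polynomial.eval_X,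
        Function.update_self, add_sub_cancel_left, mul_pow]
      ring
    · simp

/-- side lengths of the localized block -/
noncomputable def sideR (d s : ℕ) (α : Fin d → ℕ) (c w : ℝ) (k : Fin d) : ℝ :=
  if (k : ℕ) < s then w ^ ((α k : ℝ)⁻¹) else c

/-- corner of the localized block -/
noncomputable def corner (d s : ℕ) (α : Fin d → ℕ) (c w : ℝ) (x₀ : Fin d → ℝ) (e : ℝ)
    (T : Finset (Fin d)) : Fin d → ℝ :=
  fun k => x₀ k + e * (if k ∈ T then sideR d s α c w k else 0)

/-- pointwise smallness requirement -/
def goodW (d s : ℕ) (α : Fin d → ℕ) (f : (Fin d → ℝ) → ℝ) (x₀ : Fin d → ℝ) (c L w : ℝ) : Prop :=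
  0 < w ∧ (∀ k : Fin d, (k : ℕ) < s → (α k + 1 : ℝ) * w ^ ((α k : ℝ)⁻¹) ≤ c) ∧
  ∀ x : Fin d → ℝ, x ∈ Set.Icc (0 : Fin d → ℝ) 1 →
    (∀ k : Fin d, |x k - x₀ k| ≤ L * rVec d s α w k) → |f x - taylorJ0 d s α f x₀ x| ≤ w

lemma bias_pt (d s : ℕ) (α : Fin d → ℕ) (f : (Fin d → ℝ) → ℝ) (x₀ : Fin d → ℝ) (c L : ℝ)
    (hc0 : 0 < c) (hc1 : c ≤ 1) (hL : ∀ k, (α k + 1 : ℝ) ≤ L)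
    (hx1 : ∀ k, c ≤ x₀ k) (hx2 : ∀ k, x₀ k + c ≤ 1)
    (hmono : MonotoneOn f (Set.Icc (0 : Fin d → ℝ) 1))
    (hα : ∀ k : Fin d, (k : ℕ) < s → 1 ≤ α k)
    (hder : ∀ k : Fin d, (k : ℕ) < s → ∀ j : ℕ, 1 ≤ j → j ≤ α k - 1 → pderivIter d k j f x₀ = 0)
    (e : ℝ) (he : e = 1 ∨ e = -1) (T : Finset (Fin d)) :
    ∃ B : ℝ, ∀ w : ℝ, goodW d s α f x₀ c L w → |f (corner d s α c w x₀ e T) - f x₀| ≤ B * w := by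
  have habs : |e| = 1 := by rcases he with rfl | rfl <;> simp
  have hIcc : ∀ w, goodW d s α f x₀ c L w → ∀ x : Fin d → ℝ,
      (∀ k, |x k - x₀ k| ≤ if (k : ℕ) < s then (α k + 1 : ℝ) * w ^ ((α k : ℝ)⁻¹) else c) →
      x ∈ Set.Icc (0 : Fin d → ℝ) 1 ∧ |f x - taylorJ0 d s α f x₀ x| ≤ w := by
    intro w hw x hx
    have hxc : ∀ k, |x k - x₀ k| ≤ c := by
      intro k
      have h1 := hx k
      split_ifs at h1 with hk
      · exact h1.trans (hw.2.1 k hk)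
      · exact h1
    have hmem : x ∈ Set.Icc (0 : Fin d → ℝ) 1 := by
      refine ⟨fun k => ?_, fun k => ?_⟩
      · have := abs_le.1 (hxc k); have := hx1 k; simp only [Pi.zero_apply]; linarith
      · have := abs_le.1 (hxc k); have := hx2 k; simp only [Pi.one_apply]; linarith
    refine ⟨hmem, hw.2.2 x hmem fun k => (hx k).trans ?_⟩
    unfold rVec
    have hw0 := hw.1
    split_ifs with hk
    · exact mul_le_mul_of_nonneg_right (hL k) (by positivity)
    · have := hL k
      have : (0 : ℝ) ≤ α k := Nat.cast_nonneg _
      linarith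
  have hside : ∀ w, 0 < w → ∀ k, 0 ≤ sideR d s α c w k := by
    intro w hw k
    unfold sideR
    split_ifs <;> positivity
  have hle : ∀ w, 0 < w → ∀ k : Fin d, sideR d s α c w k ≤
      if (k : ℕ) < s then (α k + 1 : ℝ) * w ^ ((α k : ℝ)⁻¹) else c := by
    intro w hw k
    unfold sideR
    split_ifs
    · have h1 : (0 : ℝ) ≤ w ^ ((α k : ℝ)⁻¹) := by positivity
      have : (0 : ℝ) ≤ α k := Nat.cast_nonneg _
      nlinarith
    · exact le_rfl
  have hcorner : ∀ T w, 0 < w → ∀ k, |corner d s α c w x₀ e T k - x₀ k| ≤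
      if (k : ℕ) < s then (α k + 1 : ℝ) * w ^ ((α k : ℝ)⁻¹) else c := by
    intro T w hw k
    refine le_trans ?_ (hle w hw k)
    simp only [corner, add_sub_cancel_left, abs_mul, habs, one_mul]
    split_ifs
    · rw [abs_of_nonneg (hside w hw k)]
    · simpa using hside w hw k
  induction T using Finset.induction_on with
  | empty =>
    refine ⟨0, fun w _ => ?_⟩
    have : corner d s α c w x₀ e ∅ = x₀ := by ext k; simp [corner]
    rw [this]; simp
  | insert k T hk ih =>
    obtain ⟨B, hB⟩ := ih
    by_cases hks : (k : ℕ) < s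
    · obtain ⟨A, hA0, hA⟩ := taylor_axis d s α f x₀ k (hα k hks) hks (hder k hks)
      refine ⟨1 + 2 ^ (α k + 1) * (2 + B + A * (α k : ℝ) ^ (α k)), fun w hw => ?_⟩
      have hw0 := hw.1
      set r := w ^ ((α k : ℝ)⁻¹) with hr
      have hr0 : 0 ≤ r := by positivity
      have hrα : r ^ (α k) = w := by
        rw [hr, ← Real.rpow_natCast, ← Real.rpow_mul hw0.le, inv_mul_cancel₀, Real.rpow_one]
        have := hα k hks
        positivity
      set z := corner d s α c w x₀ e T with hz
      obtain ⟨p, hpd, hp⟩ := taylor_poly d s α f x₀ z k (e * r) (f x₀)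
      have hzk : z k = x₀ k := by simp [hz, corner, hk]
      have hnew : corner d s α c w x₀ e (insert k T) = Function.update z k (x₀ k + (e * r) * 1) := by
        ext k'
        by_cases hk' : k' = k
        · subst hk'
          simp [corner, sideR, hks, hr]
        · rw [Function.update_of_ne hk']
          simp [hz, corner, hk']
      have hbd : ∀ i : ℕ, i ≤ α k → |p.eval (-(i : ℝ))| ≤ (2 + B + A * (α k : ℝ) ^ (α k)) * w := by
        intro i hi
        have hiR : (i : ℝ) ≤ α k := by exact_mod_cast hi
        have hi0 : (0 : ℝ) ≤ i := Nat.cast_nonneg i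
        set h : ℝ := e * r * -(i : ℝ) with hh
        have habsh : |h| = i * r := by
          rw [hh, abs_mul, abs_mul, habs, abs_neg, abs_of_nonneg hr0, abs_of_nonneg hi0]; ring
        have hstep : |h| ≤ (α k + 1 : ℝ) * r := by rw [habsh]; nlinarith
        set u := Function.update z k (x₀ k + h) with hu
        set v := Function.update x₀ k (x₀ k + h) with hv
        have gu := hIcc w hw u (by
          intro k'
          by_cases hk' : k' = k
          · subst hk'; simpa [hu, hks] using hstep
          · rw [hu, Function.update_of_ne hk']; exact hcorner T w hw0 k')
        have gv := hIcc w hw v (by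
          intro k'
          by_cases hk' : k' = k
          · subst hk'; simpa [hv, hks] using hstep
          · rw [hv, Function.update_of_ne hk', sub_self, abs_zero]
            exact (hside w hw0 k').trans (hle w hw0 k'))
        have gz := hIcc w hw z (hcorner T w hw0)
        have hBz := hB w hw
        have hAv : |taylorJ0 d s α f x₀ v - f x₀| ≤ A * (α k : ℝ) ^ (α k) * w := by
          refine (hA h).trans ?_
          rw [habsh, mul_pow, hrα, mul_assoc]
          gcongr
        have hfv : |f v - f x₀| ≤ w + A * (α k : ℝ) ^ (α k) * w := by
          have h1 := gv.2
          have : f v - f x₀ = (f v - taylorJ0 d s α f x₀ v) + (taylorJ0 d s α f x₀ v - f x₀) := by ring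
          rw [this]
          exact (abs_add_le _ _).trans (add_le_add h1 hAv)
        have hfu : |f u - f x₀| ≤ |f z - f x₀| + |f v - f x₀| := by
          rcases he with rfl | rfl
          · have h1 : f u ≤ f z := hmono gu.1 gz.1 (by
              intro k'
              by_cases hk' : k' = k
              · subst hk'; rw [hu, Function.update_self, hzk, hh]; nlinarith
              · rw [hu, Function.update_of_ne hk'])
            have h2 : f v ≤ f u := hmono gv.1 gu.1 (by
              intro k'
              by_cases hk' : k' = k
              · subst hk'; rw [hu, hv, Function.update_self, Function.update_self]
              · rw [hu, hv, Function.update_of_ne hk', Function.update_of_ne hk']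
                have := hside w hw0 k'
                simp only [hz, corner]
                split_ifs <;> linarith)
            rw [abs_le]
            constructor
            · have := neg_abs_le (f v - f x₀); have := abs_nonneg (f z - f x₀); linarith
            · have := le_abs_self (f z - f x₀); have := abs_nonneg (f v - f x₀); linarith
          · have h1 : f z ≤ f u := hmono gz.1 gu.1 (by
              intro k'
              by_cases hk' : k' = k
              · subst hk'; rw [hu, Function.update_self, hzk, hh]; nlinarith
              · rw [hu, Function.update_of_ne hk'])
            have h2 : f u ≤ f v := hmono gu.1 gv.1 (by
              intro k'
              by_cases hk' : k' = k
              · subst hk'; rw [hu, hv, Function.update_self, Function.update_self]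
              · rw [hu, hv, Function.update_of_ne hk', Function.update_of_ne hk']
                have := hside w hw0 k'
                simp only [hz, corner]
                split_ifs <;> linarith)
            rw [abs_le]
            constructor
            · have := neg_abs_le (f z - f x₀); have := abs_nonneg (f v - f x₀); linarith
            · have := le_abs_self (f v - f x₀); have := abs_nonneg (f z - f x₀); linarith
        rw [hp]
        have : taylorJ0 d s α f x₀ u - f x₀ = (f u - f x₀) - (f u - taylorJ0 d s α f x₀ u) := by ring
        rw [← hu, this]
        have h3 := abs_sub (f u - f x₀) (f u - taylorJ0 d s α f x₀ u)
        have h4 := gu.2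
        linarith
      have hex := extrap p (α k) hpd _ hbd
      rw [hp, ← hnew] at hex
      have hn := (hIcc w hw _ (hcorner (insert k T) w hw0)).2
      have : f (corner d s α c w x₀ e (insert k T)) - f x₀ =
        (f (corner d s α c w x₀ e (insert k T)) -
          taylorJ0 d s α f x₀ (corner d s α c w x₀ e (insert k T))) +
        (taylorJ0 d s α f x₀ (corner d s α c w x₀ e (insert k T)) - f x₀) := by ring
      rw [this]
      refine (abs_add_le _ _).trans ?_
      linarith
    · refine ⟨2 + B, fun w hw => ?_⟩
      have h1 := (hIcc w hw _ (hcorner (insert k T) w hw.1)).2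
      have h2 := (hIcc w hw _ (hcorner T w hw.1)).2
      have h3 := hB w hw
      have h4 : taylorJ0 d s α f x₀ (corner d s α c w x₀ e (insert k T)) =
          taylorJ0 d s α f x₀ (corner d s α c w x₀ e T) := by
        apply taylor_congr
        intro k' hk'
        have : k' ≠ k := by rintro rfl; exact hks hk'
        simp [corner, this]
      rw [h4] at h1
      rw [abs_le] at *
      constructor <;> linarith

lemma goodW_ev (d s : ℕ) (α : Fin d → ℕ) (f : (Fin d → ℝ) → ℝ) (x₀ : Fin d → ℝ) (c L : ℝ)
    (hc0 : 0 < c) (hL : 0 < L) (hA : AssumptionA1 d s α f x₀)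
    (w : ℕ → ℝ) (hw0 : ∀ n, 0 < w n) (hwa : Antitone w) (hwt : Tendsto w atTop (nhds 0)) :
    ∀ᶠ n in atTop, goodW d s α f x₀ c L (w n) := by
  obtain ⟨-, -, hmono, hα, -, -, hT⟩ := hA
  have h1 := hT L hL w hw0 hwa hwt
  have h2 : ∀ᶠ n in atTop, ∀ k : Fin d, (k : ℕ) < s →
      (α k + 1 : ℝ) * (w n) ^ ((α k : ℝ)⁻¹) ≤ c := by
    rw [Filter.eventually_all]
    intro k
    by_cases hk : (k : ℕ) < s
    · have hp : (0 : ℝ) < (α k : ℝ)⁻¹ := by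
        have := hα k hk
        positivity
      have h3 : Tendsto (fun n => (α k + 1 : ℝ) * (w n) ^ ((α k : ℝ)⁻¹)) atTop (nhds 0) := by
        have := (hwt.rpow_const (p := (α k : ℝ)⁻¹) (Or.inr hp.le)).const_mul (α k + 1 : ℝ)
        rwa [Real.zero_rpow hp.ne', mul_zero] at this
      filter_upwards [h3.eventually (gt_mem_nhds hc0)] with n hn _
      exact le_of_lt hn
    · exact Eventually.of_forall fun n h => absurd h hk
  have hcont : Continuous (fun x => taylorJ0 d s α f x₀ x) := by
    unfold taylorJ0
    refine continuous_finset_sum _ fun j _ => ?_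
    split_ifs
    · fun_prop
    · fun_prop
  obtain ⟨Ct, hCt⟩ := (isCompact_Icc (a := (0 : Fin d → ℝ)) (b := 1)).exists_bound_of_continuousOn
    hcont.continuousOn
  filter_upwards [h2, h1.eventually (gt_mem_nhds one_pos)] with n hn1 hn2
  refine ⟨hw0 n, hn1, fun x hx hxk => ?_⟩
  have hbdd : BddAbove {y : ℝ | ∃ x : Fin d → ℝ, x ∈ Set.Icc (0 : Fin d → ℝ) 1 ∧
        (∀ k : Fin d, |x k - x₀ k| ≤ L * rVec d s α (w n) k) ∧
        y = |f x - taylorJ0 d s α f x₀ x|} := by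
    refine ⟨|f 0| + |f 1| + Ct, ?_⟩
    rintro y ⟨x, hx, -, rfl⟩
    have e0 : f 0 ≤ f x := hmono ⟨le_rfl, zero_le_one⟩ hx hx.1
    have e1 : f x ≤ f 1 := hmono hx ⟨zero_le_one, le_rfl⟩ hx.2
    have e2 := abs_le.1 (show |_| ≤ Ct from hCt x hx)
    have := neg_abs_le (f 0); have := le_abs_self (f 1)
    have := abs_nonneg (f 0); have := abs_nonneg (f 1)
    rw [abs_le]; constructor <;> linarith
  have h4 := le_csSup hbdd ⟨x, hx, hxk, rfl⟩
  refine h4.trans ?_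
  have := hw0 n
  rw [inv_mul_lt_iff₀ this] at hn2
  linarith

/-- lattice with fixed dimensions -/
noncomputable def gpt {d : ℕ} (N : Fin d → ℕ) (a : Fin d → ℝ) (v : ∀ k, Fin (N k)) : Fin d → ℝ :=
  fun k => a k + (v k : ℝ) / (N k : ℝ)

/-- upper chain -/
noncomputable def cup {d : ℕ} (N : Fin d → ℕ) (a : Fin d → ℝ) (v : ∀ k, Fin (N k)) (xv : Fin d → ℝ)
    (k : Fin d) (c : ℕ) : Finset (Fin (N k)) :=
  haveI := Classical.decPred fun i : Fin (N k) => (v k : ℕ) ≤ i + c ∧ a k + (i : ℝ) / (N k : ℝ) ≤ xv k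
  Finset.univ.filter (fun i : Fin (N k) => (v k : ℕ) ≤ i + c ∧ a k + (i : ℝ) / (N k : ℝ) ≤ xv k)

/-- lower chain -/
noncomputable def clo {d : ℕ} (N : Fin d → ℕ) (a : Fin d → ℝ) (v : ∀ k, Fin (N k)) (xu : Fin d → ℝ)
    (k : Fin d) (c : ℕ) : Finset (Fin (N k)) :=
  haveI := Classical.decPred fun i : Fin (N k) => (i : ℕ) ≤ v k + c ∧ xu k ≤ a k + (i : ℝ) / (N k : ℝ)
  Finset.univ.filter (fun i : Fin (N k) => (i : ℕ) ≤ v k + c ∧ xu k ≤ a k + (i : ℝ) / (N k : ℝ))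

lemma mem_cup {d : ℕ} (N : Fin d → ℕ) (a : Fin d → ℝ) (v : ∀ k, Fin (N k)) (xv : Fin d → ℝ)
    (k : Fin d) (c : ℕ) (i : Fin (N k)) :
    i ∈ cup N a v xv k c ↔ (v k : ℕ) ≤ i + c ∧ a k + (i : ℝ) / (N k : ℝ) ≤ xv k := by
  simp [cup]

lemma mem_clo {d : ℕ} (N : Fin d → ℕ) (a : Fin d → ℝ) (v : ∀ k, Fin (N k)) (xv : Fin d → ℝ)
    (k : Fin d) (c : ℕ) (i : Fin (N k)) :
    i ∈ clo N a v xv k c ↔ (i : ℕ) ≤ v k + c ∧ xv k ≤ a k + (i : ℝ) / (N k : ℝ) := by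
  simp [clo]

lemma floor_aux (N : ℕ) (a y : ℝ) (v i : ℕ) (hv : v ≤ N) (hN : 0 < N) (hy : y ≤ a + (v : ℝ) / N) :
    y ≤ a + (i : ℝ) / N ↔ v ≤ i + min ⌊(a + (v : ℝ) / N - y) * N⌋₊ N := by
  have hN' : (0 : ℝ) < N := by exact_mod_cast hN
  have h0 : 0 ≤ (a + (v : ℝ) / N - y) * N := mul_nonneg (by linarith) hN'.le
  have e1 : (a + (v : ℝ) / N - y) * N = v - (y - a) * N := by field_simp; ring
  have e2 : (y ≤ a + (i : ℝ) / N) ↔ (y - a) * N ≤ i := by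
    rw [← le_div_iff₀ hN']; constructor <;> intro h <;> linarith
  have e3 : v ≤ i + min ⌊(a + (v : ℝ) / N - y) * N⌋₊ N ↔ v - i ≤ ⌊(a + (v : ℝ) / N - y) * N⌋₊ := by
    omega
  rw [e2, e3, Nat.le_floor_iff h0, e1]
  rw [e1] at h0
  rcases le_total i v with h | h
  · rw [Nat.cast_sub h]; constructor <;> intro h <;> linarith
  · have : (v : ℝ) ≤ i := by exact_mod_cast h
    rw [Nat.sub_eq_zero_of_le h, Nat.cast_zero]; constructor <;> intro h <;> linarith

lemma floor_aux2 (N : ℕ) (a y : ℝ) (v i : ℕ) (hi : i ≤ N) (hN : 0 < N) (hy : a + (v : ℝ) / N ≤ y) :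
    a + (i : ℝ) / N ≤ y ↔ i ≤ v + min ⌊(y - (a + (v : ℝ) / N)) * N⌋₊ N := by
  have hN' : (0 : ℝ) < N := by exact_mod_cast hN
  have h0 : 0 ≤ (y - (a + (v : ℝ) / N)) * N := mul_nonneg (by linarith) hN'.le
  have e1 : (y - (a + (v : ℝ) / N)) * N = (y - a) * N - v := by field_simp; ring
  have e2 : (a + (i : ℝ) / N ≤ y) ↔ i ≤ (y - a) * N := by
    rw [← div_le_iff₀ hN']; constructor <;> intro h <;> linarith
  have e3 : i ≤ v + min ⌊(y - (a + (v : ℝ) / N)) * N⌋₊ N ↔ i - v ≤ ⌊(y - (a + (v : ℝ) / N)) * N⌋₊ := by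
    omega
  rw [e2, e3, Nat.le_floor_iff h0, e1]
  rw [e1] at h0
  rcases le_total v i with h | h
  · rw [Nat.cast_sub h]; constructor <;> intro h <;> linarith
  · have : (i : ℝ) ≤ v := by exact_mod_cast h
    rw [Nat.sub_eq_zero_of_le h, Nat.cast_zero]; constructor <;> intro h <;> linarith

lemma blk_up {d : ℕ} (N : Fin d → ℕ) (a : Fin d → ℝ) (v : ∀ k, Fin (N k)) (xu xv : Fin d → ℝ)
    (hu : xu ≤ gpt N a v) :
    ∃ c : Fin d → ℕ, (∀ k, c k ≤ N k) ∧ ∀ i, i ∈ Fintype.piFinset (fun k => cup N a v xv k (c k)) ↔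
      gpt N a i ∈ Set.Icc xu xv := by
  refine ⟨fun k => min ⌊(gpt N a v k - xu k) * N k⌋₊ (N k), fun k => min_le_right _ _, fun i => ?_⟩
  simp only [Fintype.mem_piFinset, mem_cup, Set.mem_Icc, Pi.le_def, ← forall_and]
  refine forall_congr' fun k => and_congr_left fun _ => ?_
  exact (floor_aux (N k) (a k) (xu k) (v k) (i k) (v k).2.le ((Nat.zero_le _).trans_lt (v k).2) (hu k)).symm

lemma blk_lo {d : ℕ} (N : Fin d → ℕ) (a : Fin d → ℝ) (v : ∀ k, Fin (N k)) (xu xv : Fin d → ℝ)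
    (hv : gpt N a v ≤ xv) :
    ∃ c : Fin d → ℕ, (∀ k, c k ≤ N k) ∧ ∀ i, i ∈ Fintype.piFinset (fun k => clo N a v xu k (c k)) ↔
      gpt N a i ∈ Set.Icc xu xv := by
  refine ⟨fun k => min ⌊(xv k - gpt N a v k) * N k⌋₊ (N k), fun k => min_le_right _ _, fun i => ?_⟩
  simp only [Fintype.mem_piFinset, mem_clo, Set.mem_Icc, Pi.le_def, ← forall_and]
  refine forall_congr' fun k => and_comm.trans (and_congr_right fun _ => ?_)
  exact (floor_aux2 (N k) (a k) (xv k) (v k) (i k) (i k).2.le ((Nat.zero_le _).trans_lt (v k).2) (hv k)).symm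

lemma blockAvg_eq {d : ℕ} {ι : Type*} [Fintype ι] (X : ι → (Fin d → ℝ)) (Y : ι → ℝ)
    (xu xv : Fin d → ℝ) (S : Finset ι) (hS : ∀ i, i ∈ S ↔ X i ∈ Set.Icc xu xv) :
    blockAvg X Y xu xv = (∑ i ∈ S, Y i) / (S.card : ℝ) := by
  unfold blockAvg
  have : (@Finset.filter ι (fun i => X i ∈ Set.Icc xu xv)
      (Classical.decPred fun i => X i ∈ Set.Icc xu xv) Finset.univ) = S := by
    ext i; simp [hS i]
  simp only [this]

lemma blockAvg_bdd {d : ℕ} {ι : Type*} [Fintype ι] (X : ι → (Fin d → ℝ)) (Y : ι → ℝ) :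
    ∃ D : ℝ, ∀ xu xv, |blockAvg X Y xu xv| ≤ D := by
  classical
  obtain ⟨D, hD⟩ := (Set.finite_range (fun S : Finset ι => |(∑ i ∈ S, Y i) / (S.card : ℝ)|)).bddAbove
  refine ⟨D, fun xu xv => ?_⟩
  rw [blockAvg_eq X Y xu xv (Finset.univ.filter fun i => X i ∈ Set.Icc xu xv) (by simp)]
  exact hD ⟨_, rfl⟩

lemma det_upper {d : ℕ} (N : Fin d → ℕ) (a : Fin d → ℝ) (v : ∀ k, Fin (N k)) (xv : Fin d → ℝ)
    (f : (Fin d → ℝ) → ℝ) (ξ : (∀ k, Fin (N k)) → ℝ) (t : ℝ)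
    (hmono : MonotoneOn f (Set.Icc (0 : Fin d → ℝ) 1))
    (hX : ∀ i, gpt N a i ∈ Set.Icc (0 : Fin d → ℝ) 1) (hxv : xv ∈ Set.Icc (0 : Fin d → ℝ) 1)
    (hle : gpt N a v ≤ xv)
    (hn : ∀ c : Fin d → ℕ, (∀ k, c k ≤ N k) →
      |∑ i ∈ Fintype.piFinset (fun k => cup N a v xv k (c k)), ξ i| ≤
        t * ∏ k, ((cup N a v xv k (c k)).card : ℝ)) :
    maxMinEst (gpt N a) (fun i => f (gpt N a i) + ξ i) (gpt N a v) ≤ f xv + t := by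
  unfold maxMinEst
  refine csSup_le ⟨_, gpt N a v, le_rfl, rfl⟩ ?_
  rintro z ⟨xu, hxu, rfl⟩
  obtain ⟨D, hD⟩ := blockAvg_bdd (gpt N a) (fun i => f (gpt N a i) + ξ i)
  have hb : BddBelow {w : ℝ | ∃ xv : Fin d → ℝ, gpt N a v ≤ xv ∧ (∃ i, gpt N a i ∈ Set.Icc xu xv) ∧
      w = blockAvg (gpt N a) (fun i => f (gpt N a i) + ξ i) xu xv} := by
    refine ⟨-D, ?_⟩
    rintro w ⟨x, -, -, rfl⟩
    exact (abs_le.1 (hD _ _)).1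
  refine (csInf_le hb ⟨xv, hle, ⟨v, hxu, hle⟩, rfl⟩).trans ?_
  obtain ⟨c, hc, hS⟩ := blk_up N a v xu xv hxu
  rw [blockAvg_eq _ _ _ _ _ hS]
  have h1 := hn c hc
  have hcard : ((Fintype.piFinset (fun k => cup N a v xv k (c k))).card : ℝ) =
      ∏ k, ((cup N a v xv k (c k)).card : ℝ) := by
    rw [Fintype.card_piFinset]; push_cast; rfl
  rw [← hcard] at h1
  have hpos : (0 : ℝ) < (Fintype.piFinset (fun k => cup N a v xv k (c k))).card := by
    exact_mod_cast Finset.card_pos.2 ⟨v, (hS v).2 ⟨hxu, hle⟩⟩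
  rw [div_le_iff₀ hpos, Finset.sum_add_distrib]
  have h2 : ∑ i ∈ Fintype.piFinset (fun k => cup N a v xv k (c k)), f (gpt N a i) ≤
      (Fintype.piFinset (fun k => cup N a v xv k (c k))).card * f xv := by
    rw [← nsmul_eq_mul]
    exact Finset.sum_le_card_nsmul _ _ _ fun i hi => hmono (hX i) hxv ((hS i).1 hi).2
  have := (abs_le.1 h1).2
  nlinarith

lemma det_lower {d : ℕ} (N : Fin d → ℕ) (a : Fin d → ℝ) (v : ∀ k, Fin (N k)) (xu : Fin d → ℝ)
    (f : (Fin d → ℝ) → ℝ) (ξ : (∀ k, Fin (N k)) → ℝ) (t : ℝ)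
    (hmono : MonotoneOn f (Set.Icc (0 : Fin d → ℝ) 1))
    (hX : ∀ i, gpt N a i ∈ Set.Icc (0 : Fin d → ℝ) 1) (hxu : xu ∈ Set.Icc (0 : Fin d → ℝ) 1)
    (hle : xu ≤ gpt N a v)
    (hn : ∀ c : Fin d → ℕ, (∀ k, c k ≤ N k) →
      |∑ i ∈ Fintype.piFinset (fun k => clo N a v xu k (c k)), ξ i| ≤
        t * ∏ k, ((clo N a v xu k (c k)).card : ℝ)) :
    f xu - t ≤ maxMinEst (gpt N a) (fun i => f (gpt N a i) + ξ i) (gpt N a v) := by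
  unfold maxMinEst
  obtain ⟨D, hD⟩ := blockAvg_bdd (gpt N a) (fun i => f (gpt N a i) + ξ i)
  have hb : ∀ xu, BddBelow {w : ℝ | ∃ xv : Fin d → ℝ, gpt N a v ≤ xv ∧ (∃ i, gpt N a i ∈ Set.Icc xu xv) ∧
      w = blockAvg (gpt N a) (fun i => f (gpt N a i) + ξ i) xu xv} := by
    intro xu
    refine ⟨-D, ?_⟩
    rintro w ⟨x, -, -, rfl⟩
    exact (abs_le.1 (hD _ _)).1
  refine le_trans ?_ (le_csSup ⟨D, ?_⟩ ⟨xu, hle, rfl⟩)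
  swap
  · rintro z ⟨x, hx, rfl⟩
    exact (csInf_le (hb x) ⟨gpt N a v, le_rfl, ⟨v, hx, le_rfl⟩, rfl⟩).trans (abs_le.1 (hD _ _)).2
  refine le_csInf ⟨_, gpt N a v, le_rfl, ⟨v, hle, le_rfl⟩, rfl⟩ ?_
  rintro w ⟨xv, hxv, -, rfl⟩
  obtain ⟨c, hc, hS⟩ := blk_lo N a v xu xv hxv
  rw [blockAvg_eq _ _ _ _ _ hS]
  have h1 := hn c hc
  have hcard : ((Fintype.piFinset (fun k => clo N a v xu k (c k))).card : ℝ) =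
      ∏ k, ((clo N a v xu k (c k)).card : ℝ) := by
    rw [Fintype.card_piFinset]; push_cast; rfl
  rw [← hcard] at h1
  have hpos : (0 : ℝ) < (Fintype.piFinset (fun k => clo N a v xu k (c k))).card := by
    exact_mod_cast Finset.card_pos.2 ⟨v, (hS v).2 ⟨hle, hxv⟩⟩
  rw [le_div_iff₀ hpos, Finset.sum_add_distrib]
  have h2 : (Fintype.piFinset (fun k => clo N a v xu k (c k))).card * f xu ≤
      ∑ i ∈ Fintype.piFinset (fun k => clo N a v xu k (c k)), f (gpt N a i) := by
    rw [← nsmul_eq_mul]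
    exact Finset.card_nsmul_le_sum _ _ _ fun i hi => hmono hxu (hX i) ((hS i).1 hi).1
  have := (abs_le.1 h1).1
  nlinarith

lemma cup_mono {d : ℕ} (N : Fin d → ℕ) (a : Fin d → ℝ) (v : ∀ k, Fin (N k)) (xv : Fin d → ℝ)
    (k : Fin d) : Monotone (cup N a v xv k) := by
  intro c c' h i hi
  rw [mem_cup] at hi ⊢
  exact ⟨by omega, hi.2⟩

lemma clo_mono {d : ℕ} (N : Fin d → ℕ) (a : Fin d → ℝ) (v : ∀ k, Fin (N k)) (xv : Fin d → ℝ)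
    (k : Fin d) : Monotone (clo N a v xv k) := by
  intro c c' h i hi
  rw [mem_clo] at hi ⊢
  exact ⟨by omega, hi.2⟩

lemma cup_card {d : ℕ} (N : Fin d → ℕ) (a : Fin d → ℝ) (v : ∀ k, Fin (N k)) (xv : Fin d → ℝ)
    (k : Fin d) (r : ℝ) (hr : 0 ≤ r) (ha : 0 ≤ a k) (hxv : gpt N a v k + r ≤ xv k)
    (h1 : gpt N a v k + r < 1) : 1 ≤ (cup N a v xv k 0).card ∧ N k * r ≤ (cup N a v xv k 0).card := by
  have hN : (0 : ℝ) < N k := by exact_mod_cast (Nat.zero_le _).trans_lt (v k).2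
  have hm : ∀ m : ℕ, m ≤ ⌊N k * r⌋₊ → (m : ℝ) ≤ N k * r := fun m h =>
    (Nat.le_floor_iff (by positivity)).1 h
  unfold gpt at hxv h1
  have hlt : ∀ m : ℕ, m ≤ ⌊N k * r⌋₊ → (v k : ℕ) + m < N k := by
    intro m h
    have := hm m h
    have e : (v k : ℝ) / N k + r < 1 := by linarith
    have e2 : ((v k : ℝ) / N k + r) * N k < 1 * N k := by gcongr
    rw [add_mul, div_mul_cancel₀ _ hN.ne'] at e2
    have : ((v k : ℕ) : ℝ) + m < N k := by linarith
    exact_mod_cast this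
  have hc : ⌊N k * r⌋₊ + 1 ≤ (cup N a v xv k 0).card := by
    have := Finset.card_le_card_of_injOn (s := (Finset.univ : Finset (Fin (⌊N k * r⌋₊ + 1))))
      (t := cup N a v xv k 0) (fun j => ⟨v k + j, hlt j (by omega)⟩) ?_ ?_
    · simpa using this
    · intro j _
      rw [Finset.mem_coe, mem_cup]
      refine ⟨by simp, ?_⟩
      have := hm j (by omega)
      have e : (j : ℝ) / N k ≤ r := by rw [div_le_iff₀ hN]; linarith
      push_cast
      rw [add_div]; linarith
    · intro j _ j' _ h
      simp only [Fin.mk.injEq] at h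
      ext; omega
  refine ⟨by omega, ?_⟩
  have := Nat.lt_floor_add_one (N k * r)
  have h3 : ((⌊N k * r⌋₊ + 1 : ℕ) : ℝ) ≤ (cup N a v xv k 0).card := by exact_mod_cast hc
  push_cast at h3
  linarith

lemma clo_card {d : ℕ} (N : Fin d → ℕ) (a : Fin d → ℝ) (v : ∀ k, Fin (N k)) (xu : Fin d → ℝ)
    (k : Fin d) (r : ℝ) (hr : 0 ≤ r) (ha : a k + ((N k : ℝ) - 1) / N k ≤ 1)
    (hxu : xu k ≤ gpt N a v k - r)
    (h1 : r < gpt N a v k) : 1 ≤ (clo N a v xu k 0).card ∧ N k * r ≤ (clo N a v xu k 0).card := by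
  have hN : (0 : ℝ) < N k := by exact_mod_cast (Nat.zero_le _).trans_lt (v k).2
  have hm : ∀ m : ℕ, m ≤ ⌊N k * r⌋₊ → (m : ℝ) ≤ N k * r := fun m h =>
    (Nat.le_floor_iff (by positivity)).1 h
  unfold gpt at hxu h1
  have hle : ∀ m : ℕ, m ≤ ⌊N k * r⌋₊ → m ≤ (v k : ℕ) := by
    intro m h
    have := hm m h
    have e2 : r * N k < (a k + (v k : ℝ) / N k) * N k := by gcongr
    rw [add_mul, div_mul_cancel₀ _ hN.ne'] at e2
    have e3 : (a k + ((N k : ℝ) - 1) / N k) * N k ≤ 1 * N k := by gcongr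
    rw [add_mul, div_mul_cancel₀ _ hN.ne'] at e3
    have : (m : ℝ) < (v k : ℕ) + 1 := by linarith
    have : m < (v k : ℕ) + 1 := by exact_mod_cast this
    omega
  have hc : ⌊N k * r⌋₊ + 1 ≤ (clo N a v xu k 0).card := by
    have := Finset.card_le_card_of_injOn (s := (Finset.univ : Finset (Fin (⌊N k * r⌋₊ + 1))))
      (t := clo N a v xu k 0) (fun j => ⟨v k - j, by omega⟩) ?_ ?_
    · simpa using this
    · intro j _
      rw [Finset.mem_coe, mem_clo]
      refine ⟨by simp, ?_⟩
      have := hm j (by omega)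
      have e : (j : ℝ) / N k ≤ r := by rw [div_le_iff₀ hN]; linarith
      have hj := hle j (by omega)
      simp only
      rw [Nat.cast_sub hj, sub_div]; linarith
    · intro j _ j' _ h
      simp only [Fin.mk.injEq] at h
      have := hle j (by omega)
      have := hle j' (by omega)
      ext; omega
  refine ⟨by omega, ?_⟩
  have := Nat.lt_floor_add_one (N k * r)
  have h3 : ((⌊N k * r⌋₊ + 1 : ℕ) : ℝ) ≤ (clo N a v xu k 0).card := by exact_mod_cast hc
  push_cast at h3
  linarith

lemma tail_n {d s : ℕ} {α : Fin d → ℕ} (N : Fin d → ℕ) (a : Fin d → ℝ) (v : ∀ k, Fin (N k))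
    (f : (Fin d → ℝ) → ℝ) (T : Finset (Fin d)) (c w Bd σ t : ℝ)
    (hmono : MonotoneOn f (Set.Icc (0 : Fin d → ℝ) 1))
    (ha0 : ∀ k, 0 ≤ a k) (ha1 : ∀ k, a k + ((N k : ℝ) - 1) / N k ≤ 1)
    (hr0 : ∀ k, 0 < sideR d s α c w k) (hrc : ∀ k, sideR d s α c w k ≤ c)
    (hx1 : ∀ k, c < gpt N a v k) (hx2 : ∀ k, gpt N a v k + c < 1)
    (hB1 : |f (corner d s α c w (gpt N a v) 1 T) - f (gpt N a v)| ≤ Bd)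
    (hB2 : |f (corner d s α c w (gpt N a v) (-1) T) - f (gpt N a v)| ≤ Bd)
    (ht : 0 < t)
    {Ω : Type*} [MeasurableSpace Ω] (P : Measure Ω) [IsProbabilityMeasure P]
    (ξ : (∀ k, Fin (N k)) → Ω → ℝ) (hξ : ∀ i, Measurable (ξ i))
    (hi : ProbabilityTheory.iIndepFun ξ P) (h2 : ∀ i, MemLp (ξ i) 2 P)
    (h0 : ∀ i, ∫ ω, ξ i ω ∂P = 0) (hσ : ∀ i, ∫ ω, ξ i ω ^ 2 ∂P = σ ^ 2) :
    P {ω | Bd + t < |maxMinEst (gpt N a) (fun i => f (gpt N a i) + ξ i ω) (gpt N a v) - f (gpt N a v)|} ≤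
      2 * ENNReal.ofReal (16 ^ d * σ ^ 2 / (t ^ 2 * ∏ k ∈ T, (N k * sideR d s α c w k))) := by
  set x₀ := gpt N a v with hx₀
  have hX : ∀ i, gpt N a i ∈ Set.Icc (0 : Fin d → ℝ) 1 := by
    intro i
    refine ⟨fun k => ?_, fun k => ?_⟩
    · have := ha0 k
      simp only [gpt, Pi.zero_apply]; positivity
    · have hN : (0 : ℝ) < N k := by exact_mod_cast (Nat.zero_le _).trans_lt (v k).2
      have h3 : ((i k : ℕ) : ℝ) + 1 ≤ N k := by exact_mod_cast (i k).2
      refine le_trans ?_ (ha1 k)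
      simp only [gpt]
      gcongr
      linarith
  have hc : ∀ k, 0 ≤ (if k ∈ T then sideR d s α c w k else 0) ∧
      (if k ∈ T then sideR d s α c w k else 0) ≤ c := by
    intro k
    have := hr0 k; have := hrc k
    split_ifs <;> constructor <;> linarith
  set xv := corner d s α c w x₀ 1 T with hxv
  set xu := corner d s α c w x₀ (-1) T with hxu
  have ev : ∀ k, xv k = x₀ k + (if k ∈ T then sideR d s α c w k else 0) := fun k => by
    simp only [hxv, corner]; ring
  have eu : ∀ k, xu k = x₀ k - (if k ∈ T then sideR d s α c w k else 0) := fun k => by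
    simp only [hxu, corner]; ring
  have hxvm : xv ∈ Set.Icc (0 : Fin d → ℝ) 1 := by
    refine ⟨fun k => ?_, fun k => ?_⟩ <;>
    · have := hc k; have := hx1 k; have := hx2 k
      rw [ev]; simp only [Pi.zero_apply, Pi.one_apply]; linarith
  have hxum : xu ∈ Set.Icc (0 : Fin d → ℝ) 1 := by
    refine ⟨fun k => ?_, fun k => ?_⟩ <;>
    · have := hc k; have := hx1 k; have := hx2 k
      rw [eu]; simp only [Pi.zero_apply, Pi.one_apply]; linarith
  have hv : x₀ ≤ xv := fun k => by have := hc k; rw [ev]; linarith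
  have hu : xu ≤ x₀ := fun k => by have := hc k; rw [eu]; linarith
  have cu : ∀ k, 1 ≤ (cup N a v xv k 0).card ∧
      N k * (if k ∈ T then sideR d s α c w k else 0) ≤ (cup N a v xv k 0).card := fun k =>
    cup_card N a v xv k _ (hc k).1 (ha0 k) (ev k).ge (by have := hc k; have := hx2 k; linarith)
  have cl : ∀ k, 1 ≤ (clo N a v xu k 0).card ∧
      N k * (if k ∈ T then sideR d s α c w k else 0) ≤ (clo N a v xu k 0).card := fun k =>
    clo_card N a v xu k _ (hc k).1 (ha1 k) (eu k).le (by have := hc k; have := hx1 k; linarith)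
  have hNp : ∀ k, (0 : ℝ) < N k := fun k => by exact_mod_cast (Nat.zero_le _).trans_lt (v k).2
  have hQ : 0 < ∏ k ∈ T, (N k * sideR d s α c w k) :=
    Finset.prod_pos fun k _ => mul_pos (hNp k) (hr0 k)
  have hprod : ∀ g : Fin d → ℕ, (∀ k, 1 ≤ g k ∧
      N k * (if k ∈ T then sideR d s α c w k else 0) ≤ g k) →
      ∏ k ∈ T, (N k * sideR d s α c w k) ≤ ∏ k, (g k : ℝ) := by
    intro g hg
    have : ∏ k ∈ T, (N k * sideR d s α c w k) = ∏ k, if k ∈ T then N k * sideR d s α c w k else 1 := by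
      rw [Finset.prod_ite_mem]; simp
    rw [this]
    refine Finset.prod_le_prod (fun k _ => ?_) (fun k _ => ?_)
    · split_ifs
      · exact (mul_pos (hNp k) (hr0 k)).le
      · exact zero_le_one
    · have h5 := hg k
      by_cases hk : k ∈ T
      · simpa [hk] using h5.2
      · simpa [hk] using h5.1
  have n1 := noise_bound P ξ hξ hi h2 h0 σ hσ (cup N a v xv) (cup_mono N a v xv)
    (fun k => (cu k).1) N t ht
  have n2 := noise_bound P ξ hξ hi h2 h0 σ hσ (clo N a v xu) (clo_mono N a v xu)
    (fun k => (cl k).1) N t ht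
  have hmon : ∀ q : ℝ, ∏ k ∈ T, (N k * sideR d s α c w k) ≤ q →
      ENNReal.ofReal (16 ^ Fintype.card (Fin d) * σ ^ 2 / (t ^ 2 * q)) ≤
      ENNReal.ofReal (16 ^ d * σ ^ 2 / (t ^ 2 * ∏ k ∈ T, (N k * sideR d s α c w k))) := by
    intro q hq
    rw [Fintype.card_fin]
    apply ENNReal.ofReal_le_ofReal
    gcongr
  have m1 := n1.trans (hmon _ (hprod _ cu))
  have m2 := n2.trans (hmon _ (hprod _ cl))
  rw [two_mul]
  refine le_trans (le_trans (measure_mono ?_) (measure_union_le _ _)) (add_le_add m1 m2)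
  intro ω hω
  by_contra hcon
  simp only [Set.mem_union, Set.mem_setOf_eq, not_or, not_exists, not_and, not_lt] at hcon hω
  have u1 := det_upper N a v xv f (fun i => ξ i ω) t hmono hX hxvm hv hcon.1
  have u2 := det_lower N a v xu f (fun i => ξ i ω) t hmono hX hxum hu hcon.2
  have b1 := (abs_le.1 hB1).2
  have b2 := (abs_le.1 hB2).1
  refine absurd hω (not_lt.2 (abs_le.2 ⟨?_, ?_⟩)) <;> linarith

lemma iid_facts {ι : Type*} [Fintype ι] {Ω : Type*} [MeasurableSpace Ω] (P : Measure Ω)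
    [IsProbabilityMeasure P] (μ : Measure ℝ) [IsProbabilityMeasure μ] (σ : ℝ)
    (hmean : ∫ x, x ∂μ = 0) (hvar : ∫ x, x ^ 2 ∂μ = σ ^ 2)
    (hL2 : Integrable (fun x : ℝ => x ^ 2) μ) (ξ : ι → Ω → ℝ) (hξ : ∀ i, Measurable (ξ i))
    (hiid : Measure.map (fun ω i => ξ i ω) P = Measure.pi (fun _ => μ)) :
    ProbabilityTheory.iIndepFun ξ P ∧ (∀ i, MemLp (ξ i) 2 P) ∧ (∀ i, ∫ ω, ξ i ω ∂P = 0) ∧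
      (∀ i, ∫ ω, ξ i ω ^ 2 ∂P = σ ^ 2) := by
  have hm : ∀ i, Measure.map (ξ i) P = μ := by
    intro i
    have h1 : Measure.map (fun x : ι → ℝ => x i) (Measure.map (fun ω i => ξ i ω) P) =
        Measure.map (ξ i) P := by
      rw [Measure.map_map (measurable_pi_apply i) (measurable_pi_lambda _ hξ)]; rfl
    rw [← h1, hiid]
    exact (measurePreserving_eval (fun _ : ι => μ) i).map_eq
  refine ⟨?_, fun i => ?_, fun i => ?_, fun i => ?_⟩
  · rw [ProbabilityTheory.iIndepFun_iff_map_fun_eq_pi_map (fun i => (hξ i).aemeasurable), hiid]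
    congr 1
    ext1 i
    exact (hm i).symm
  · rw [memLp_two_iff_integrable_sq (hξ i).aestronglyMeasurable]
    rw [← hm i] at hL2
    exact hL2.comp_measurable (hξ i)
  · rw [← hmean, ← hm i, integral_map (hξ i).aemeasurable]
    exact measurable_id.aestronglyMeasurable
  · rw [← hvar, ← hm i, integral_map (hξ i).aemeasurable]
    exact (measurable_id.pow_const 2).aestronglyMeasurable

lemma prod_low {d s : ℕ} {α : Fin d → ℕ} (β : Fin d → ℝ) (hβ : ∀ k, 0 < β k) (T : Finset (Fin d))
    (n : ℕ) (hn : 1 ≤ n) (c w : ℝ) (hc0 : 0 < c) (hc1 : c ≤ 1) (hw : 0 < w) :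
    (c / 2) ^ T.card * (n : ℝ) ^ (∑ k ∈ T, β k) *
      w ^ (∑ k ∈ T, if (k : ℕ) < s then ((α k : ℝ))⁻¹ else 0) ≤
    ∏ k ∈ T, ((latticeDim d β n k : ℝ) * sideR d s α c w k) := by
  have hn0 : (0 : ℝ) < n := by exact_mod_cast hn
  have hn1 : (1 : ℝ) ≤ n := by exact_mod_cast hn
  rw [Real.rpow_sum_of_pos hn0, Real.rpow_sum_of_pos hw, ← Finset.prod_const, ← Finset.prod_mul_distrib,
    ← Finset.prod_mul_distrib]
  refine Finset.prod_le_prod (fun k _ => by positivity) fun k _ => ?_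
  have h1 : (n : ℝ) ^ β k / 2 ≤ latticeDim d β n k := by
    have h2 : (1 : ℝ) ≤ (n : ℝ) ^ β k := Real.one_le_rpow hn1 (hβ k).le
    have h3 : 1 ≤ latticeDim d β n k := (Nat.one_le_floor_iff _).2 h2
    have h4 := Nat.lt_floor_add_one ((n : ℝ) ^ β k)
    have h5 : (1 : ℝ) ≤ latticeDim d β n k := by exact_mod_cast h3
    unfold latticeDim at h5 ⊢
    linarith
  have h2 : c * w ^ (if (k : ℕ) < s then ((α k : ℝ))⁻¹ else 0) ≤ sideR d s α c w k := by
    unfold sideR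
    split_ifs
    · have : 0 < w ^ ((α k : ℝ))⁻¹ := by positivity
      nlinarith
    · simp
  calc _ = ((n : ℝ) ^ β k / 2) * (c * w ^ (if (k : ℕ) < s then ((α k : ℝ))⁻¹ else 0)) := by ring
    _ ≤ _ := by gcongr

/-- Theorem 1 of the paper (local rate of convergence), fixed lattice design case:
under Assumption A1 and the β-fixed lattice design with i.i.d. mean-zero variance-σ²
errors, `(n_*/σ²)^{1/(2+Σ_{k=κ_*}^s α_k⁻¹)}·(f̂_n(x₀) − f₀(x₀)) = O_P(1)`. -/
theorem stmt8 (d s : ℕ) (hd : 1 ≤ d) (α : Fin d → ℕ) (β : Fin d → ℝ)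
    (x₀ : Fin d → ℝ) (f₀ : (Fin d → ℝ) → ℝ)
    (hA1 : AssumptionA1 d s α f₀ x₀)
    (hβ : ∀ k, β k ∈ Set.Ioo (0 : ℝ) 1) (hβsum : ∑ k : Fin d, β k = 1)
    (horder : ∀ k k' : Fin d, k ≤ k' → (k' : ℕ) < s →
      (α k : ℝ) * β k ≤ (α k' : ℝ) * β k')
    (a : ℕ → Fin d → ℝ)
    (ha_lb : ∀ n k, 0 ≤ a n k)
    (ha_ub : ∀ n k, a n k + ((latticeDim d β n k : ℝ) - 1) / (latticeDim d β n k : ℝ) ≤ 1)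
    (hx0grid : ∀ n : ℕ, 1 ≤ n →
      ∃ v : ∀ k : Fin d, Fin (latticeDim d β n k), latticePt d β a n v = x₀)
    (κ : Fin d)
    (hκ : ∀ ℓ : Fin d,
      (∑ k ∈ Finset.Ici ℓ, β k) /
          (2 + ∑ k ∈ Finset.Ici ℓ, if (k : ℕ) < s then ((α k : ℝ))⁻¹ else 0) ≤
        (∑ k ∈ Finset.Ici κ, β k) /
          (2 + ∑ k ∈ Finset.Ici κ, if (k : ℕ) < s then ((α k : ℝ))⁻¹ else 0))
    (σ : ℝ) (hσ : 0 < σ)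
    {Ω : Type*} [MeasurableSpace Ω] (P : Measure Ω) [IsProbabilityMeasure P]
    (μ : Measure ℝ) [IsProbabilityMeasure μ]
    (hmean : ∫ x, x ∂μ = 0) (hvar : ∫ x, x ^ 2 ∂μ = σ ^ 2)
    (hL2 : Integrable (fun x : ℝ => x ^ 2) μ)
    (ξ : (n : ℕ) → (∀ k : Fin d, Fin (latticeDim d β n k)) → Ω → ℝ)
    (hξmeas : ∀ n i, Measurable (ξ n i))
    (hiid : ∀ n : ℕ,
      Measure.map (fun ω (i : ∀ k : Fin d, Fin (latticeDim d β n k)) => ξ n i ω) P =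
        Measure.pi (fun _ => μ)) :
    ∀ ε : ℝ, 0 < ε → ∃ M : ℝ,
      limsup (fun n : ℕ =>
        P {ω : Ω |
          M < |(((n : ℝ) ^ (∑ k ∈ Finset.Ici κ, β k) / σ ^ 2) ^
              (1 / (2 + ∑ k ∈ Finset.Ici κ, if (k : ℕ) < s then ((α k : ℝ))⁻¹ else 0))) *
            (maxMinEst (latticePt d β a n)
                (fun i => f₀ (latticePt d β a n i) + ξ n i ω) x₀ -
              f₀ x₀)|}) atTop ≤ ENNReal.ofReal ε := by
  intro ε hε
  obtain ⟨hsd, hx01, hmono, hα, hU, hder, hT⟩ := id hA1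
  haveI : Nonempty (Fin d) := ⟨κ⟩
  set B := ∑ k ∈ Finset.Ici κ, β k with hB
  set S := ∑ k ∈ Finset.Ici κ, (if (k : ℕ) < s then ((α k : ℝ))⁻¹ else 0) with hS
  have hBpos : 0 < B := Finset.sum_pos (fun k _ => (hβ k).1) ⟨κ, by simp⟩
  have hSnn : 0 ≤ S := Finset.sum_nonneg fun k _ => by split_ifs <;> positivity
  -- the margin
  obtain ⟨c, hc0, hc1, hcx1, hcx2⟩ : ∃ c : ℝ, 0 < c ∧ c ≤ 1 ∧ (∀ k, c < x₀ k) ∧ ∀ k, x₀ k + c < 1 := by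
    obtain ⟨k1, h1⟩ := Finite.exists_min (fun k => min (x₀ k) (1 - x₀ k))
    have hp : 0 < min (x₀ k1) (1 - x₀ k1) := lt_min (hx01 k1).1 (by linarith [(hx01 k1).2])
    refine ⟨min (x₀ k1) (1 - x₀ k1) / 2, by linarith, ?_, fun k => ?_, fun k => ?_⟩
    · have := min_le_left (x₀ k1) (1 - x₀ k1); have := (hx01 k1).2; linarith
    · have := h1 k; have := min_le_left (x₀ k) (1 - x₀ k); linarith
    · have := h1 k; have := min_le_right (x₀ k) (1 - x₀ k); linarith
  obtain ⟨L, hL0, hL⟩ : ∃ L : ℝ, 0 < L ∧ ∀ k, (α k + 1 : ℝ) ≤ L := by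
    refine ⟨∑ k, (α k : ℝ) + 1, by positivity, fun k => ?_⟩
    have := Finset.single_le_sum (f := fun k => (α k : ℝ)) (fun k _ => by positivity) (Finset.mem_univ k)
    linarith
  obtain ⟨B1, hB1⟩ := bias_pt d s α f₀ x₀ c L hc0 hc1 hL (fun k => (hcx1 k).le) (fun k => (hcx2 k).le)
    hmono hα (fun k hk => (hder k hk).1) 1 (Or.inl rfl) (Finset.Ici κ)
  obtain ⟨B2, hB2⟩ := bias_pt d s α f₀ x₀ c L hc0 hc1 hL (fun k => (hcx1 k).le) (fun k => (hcx2 k).le)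
    hmono hα (fun k hk => (hder k hk).1) (-1) (Or.inr rfl) (Finset.Ici κ)
  set ρ : ℕ → ℝ := fun n => ((n : ℝ) ^ B / σ ^ 2) ^ (1 / (2 + S)) with hρ
  have hρpos : ∀ n : ℕ, 1 ≤ n → 0 < ρ n := by
    intro n hn
    have hn0 : (0 : ℝ) < n := by exact_mod_cast hn
    simp only [hρ]; positivity
  have hρmono : Monotone ρ := by
    intro n m h
    have : (n : ℝ) ≤ m := by exact_mod_cast h
    simp only [hρ]
    gcongr
  have hρt : Tendsto ρ atTop atTop := by
    have h1 : Tendsto (fun n : ℕ => (n : ℝ) ^ B / σ ^ 2) atTop atTop :=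
      ((tendsto_rpow_atTop hBpos).comp tendsto_natCast_atTop_atTop).atTop_div_const (by positivity)
    exact (tendsto_rpow_atTop (by positivity : 0 < 1 / (2 + S))).comp h1
  have hgood : ∀ᶠ n in atTop, goodW d s α f₀ x₀ c L (ρ (max n 1))⁻¹ := by
    refine goodW_ev d s α f₀ x₀ c L hc0 hL0 hA1 (fun n => (ρ (max n 1))⁻¹)
      (fun n => inv_pos.2 (hρpos _ (le_max_right _ _))) ?_ ?_
    · intro n m h
      exact inv_anti₀ (hρpos _ (le_max_right _ _)) (hρmono (max_le_max h le_rfl))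
    · refine tendsto_inv_atTop_zero.comp (hρt.comp ?_)
      exact tendsto_atTop_mono (fun n => le_max_left n 1) tendsto_id
  set c' := (c / 2) ^ (Finset.Ici κ).card with hc'
  have hc'pos : 0 < c' := by positivity
  set K := Real.sqrt (2 * 16 ^ d / (c' * ε)) with hK
  have hKpos : 0 < K := Real.sqrt_pos.2 (by positivity)
  have hK2 : K ^ 2 = 2 * 16 ^ d / (c' * ε) := Real.sq_sqrt (by positivity)
  refine ⟨max B1 B2 + K, ?_⟩
  refine limsup_le_of_le (by isBoundedDefault) ?_
  filter_upwards [hgood, eventually_ge_atTop 1] with n hgn hn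
  rw [max_eq_left hn] at hgn
  have hρn := hρpos n hn
  set w := (ρ n)⁻¹ with hw
  have hw0 : 0 < w := hgn.1
  obtain ⟨v, hv⟩ := hx0grid n hn
  obtain ⟨hi, hm2, hm0, hms⟩ := iid_facts P μ σ hmean hvar hL2 (ξ n) (hξmeas n) (hiid n)
  have hgv : gpt (latticeDim d β n) (a n) v = x₀ := hv
  have hr0 : ∀ k, 0 < sideR d s α c w k := by
    intro k; unfold sideR; split_ifs
    · positivity
    · exact hc0
  have hrc : ∀ k, sideR d s α c w k ≤ c := by
    intro k; unfold sideR; split_ifs with h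
    · refine le_trans ?_ (hgn.2.1 k h)
      have : 0 < w ^ ((α k : ℝ))⁻¹ := by positivity
      have h9 : (0 : ℝ) ≤ α k := by positivity
      nlinarith
    · exact le_rfl
  have key := tail_n (s := s) (α := α) (latticeDim d β n) (a n) v f₀ (Finset.Ici κ) c w
    (max B1 B2 * w) σ (K * w) hmono (ha_lb n) (ha_ub n) hr0 hrc
    (by rw [hgv]; exact hcx1) (by rw [hgv]; exact hcx2)
    (by rw [hgv]; exact (hB1 w hgn).trans (by gcongr; exact le_max_left _ _))
    (by rw [hgv]; exact (hB2 w hgn).trans (by gcongr; exact le_max_right _ _))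
    (by positivity) P (ξ n) (hξmeas n) hi hm2 hm0 hms
  rw [hgv] at key
  refine le_trans (measure_mono ?_) (key.trans ?_)
  · intro ω hω
    simp only [Set.mem_ofPred_eq] at hω ⊢
    change max B1 B2 + K < |ρ n * (maxMinEst (gpt (latticeDim d β n) (a n))
      (fun i => f₀ (gpt (latticeDim d β n) (a n) i) + ξ n i ω) x₀ - f₀ x₀)| at hω
    rw [abs_mul, abs_of_pos hρn] at hω
    rw [← add_mul, hw, ← div_eq_mul_inv, div_lt_iff₀ hρn, mul_comm]
    exact hω
  · have hp := prod_low (s := s) (α := α) β (fun k => (hβ k).1) (Finset.Ici κ) n hn c w hc0 hc1 hw0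
    rw [← hB, ← hS, ← hc'] at hp
    have hn0 : (0 : ℝ) < n := by exact_mod_cast hn
    have hws : w ^ 2 * w ^ S = σ ^ 2 / (n : ℝ) ^ B := by
      rw [← Real.rpow_natCast w 2, ← Real.rpow_add hw0, hw, Real.inv_rpow hρn.le]
      simp only [hρ]
      rw [← Real.rpow_mul (by positivity)]
      have : 1 / (2 + S) * (((2 : ℕ) : ℝ) + S) = 1 := by push_cast; field_simp
      rw [this, Real.rpow_one, inv_div]
    have hden : K ^ 2 * c' * σ ^ 2 ≤ (K * w) ^ 2 *
        ∏ k ∈ Finset.Ici κ, ((latticeDim d β n k : ℝ) * sideR d s α c w k) := by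
      calc K ^ 2 * c' * σ ^ 2 = K ^ 2 * c' * (n : ℝ) ^ B * (σ ^ 2 / (n : ℝ) ^ B) := by
            field_simp
        _ = (K * w) ^ 2 * (c' * (n : ℝ) ^ B * w ^ S) := by rw [← hws]; ring
        _ ≤ _ := by gcongr
    rw [show (2 : ENNReal) = ENNReal.ofReal 2 by simp, ← ENNReal.ofReal_mul (by norm_num)]
    apply ENNReal.ofReal_le_ofReal
    calc _ ≤ 2 * (16 ^ d * σ ^ 2 / (K ^ 2 * c' * σ ^ 2)) := by gcongr
      _ = ε := by rw [hK2]; field_simp
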